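/- Let L be a C^k (k ≥ 2) Tonelli Lagrangian on T𝕋ⁿ without conjugate points. Then every extremal curve c : ℝ → ℝⁿ minimizes the action between any two of its points: for all a < b, the action of c restricted to [a,b] equals 𝒜_{b−a}(c(a), c(b)). -/

import Mathlib

open MeasureTheory
open scoped NNReal

noncomputable section

abbrev E (n : ℕ) : Type := Fin n → ℝ

/-- The vector of `ℝⁿ` whose coordinates are the integers `m i`. -/
def intVec {n : ℕ} (m : Fin n → ℤ) : E n := fun i => (m i : ℝ)

/-- A Tonelli Lagrangian on `T𝕋ⁿ`, identified with a `ℤⁿ`-periodic (in `x`) function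
on `ℝⁿ × ℝⁿ` which is `Cᵏ`, uniformly superlinear in `v` and with positive definite
fiberwise Hessian. -/
structure IsTonelliLagrangian (n : ℕ) (k : ℕ∞) (L : E n × E n → ℝ) : Prop where
  smooth : ContDiff ℝ k L
  periodic : ∀ (x v : E n) (m : Fin n → ℤ), L (x + intVec m, v) = L (x, v)
  superlinear : ∀ C : ℝ, ∃ R : ℝ, ∀ (x v : E n), R ≤ ‖v‖ → C * ‖v‖ ≤ L (x, v)
  posdef : ∀ (x v w : E n), w ≠ 0 →
    0 < fderiv ℝ (fun v' => fderiv ℝ (fun v'' => L (x, v'')) v' w) v w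

/-- Partial differential of `L` in the fiber (velocity) direction. -/
def partialV (n : ℕ) (L : E n × E n → ℝ) (x v : E n) : E n →L[ℝ] ℝ :=
  fderiv ℝ (fun v' => L (x, v')) v

/-- Partial differential of `L` in the base (position) direction. -/
def partialX (n : ℕ) (L : E n × E n → ℝ) (x v : E n) : E n →L[ℝ] ℝ :=
  fderiv ℝ (fun x' => L (x', v)) x

/-- A `C²` curve satisfying the Euler–Lagrange equation
`d/dt (∂L/∂v(γ, γ')) = ∂L/∂x(γ, γ')`. -/
def IsExtremal (n : ℕ) (L : E n × E n → ℝ) (γ : ℝ → E n) : Prop :=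
  ContDiff ℝ 2 γ ∧
  ∀ t : ℝ, HasDerivAt (fun s => partialV n L (γ s) (deriv γ s))
    (partialX n L (γ t) (deriv γ t)) t

/-- `φ` is the (complete, `C^{k-1}`) Euler–Lagrange flow of `L` on `ℝⁿ × ℝⁿ`:
`φ t (x,v) = (γ t, γ' t)` where `γ` is the extremal curve with `(γ 0, γ' 0) = (x, v)`. -/
def IsELFlow (n : ℕ) (k : ℕ) (L : E n × E n → ℝ)
    (φ : ℝ → E n × E n → E n × E n) : Prop :=
  ContDiff ℝ ((k - 1 : ℕ) : ℕ∞) (fun p : ℝ × (E n × E n) => φ p.1 p.2) ∧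
  (∀ z : E n × E n, φ 0 z = z) ∧
  ∀ x v : E n, IsExtremal n L (fun t => (φ t (x, v)).1) ∧
    ∀ t : ℝ, (φ t (x, v)).2 = deriv (fun s => (φ s (x, v)).1) t

/-- The flow `φ` has no conjugate points: for `t ≠ 0` the image of the vertical
subspace `{0} × ℝⁿ` under `Dφ_t(z)` meets `{0} × ℝⁿ` only in `0`. -/
def NoConjugatePoints (n : ℕ) (φ : ℝ → E n × E n → E n × E n) : Prop :=
  ∀ (z : E n × E n) (t : ℝ), t ≠ 0 → ∀ w : E n,
    (fderiv ℝ (φ t) z (0, w)).1 = 0 → w = 0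

/-- The absolutely continuous curve starting at `x` with derivative `g`. -/
def curveOf (n : ℕ) (x : E n) (g : ℝ → E n) : ℝ → E n :=
  fun s => x + ∫ u in (0:ℝ)..s, g u

/-- `Acost n L t x y` = the infimum of the Lagrangian action over all absolutely
continuous curves `c : [0,t] → ℝⁿ` with `c 0 = x` and `c t = y`. -/
def Acost (n : ℕ) (L : E n × E n → ℝ) (t : ℝ) (x y : E n) : ℝ :=
  sInf { A : ℝ | ∃ g : ℝ → E n,
    IntervalIntegrable g volume 0 t ∧
    curveOf n x g t = y ∧
    IntervalIntegrable (fun s => L (curveOf n x g s, g s)) volume 0 t ∧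
    A = ∫ s in (0:ℝ)..t, L (curveOf n x g s, g s) }

namespace IsTonelliLagrangian

variable {n : ℕ} {k : ℕ∞} {L : E n × E n → ℝ}

lemma contDiff_two (hL : IsTonelliLagrangian n k L) (hk : 2 ≤ k) : ContDiff ℝ 2 L :=
  hL.smooth.of_le (by
    rw [show (2 : WithTop ℕ∞) = ((2 : ℕ∞) : WithTop ℕ∞) from rfl]
    exact WithTop.coe_le_coe.mpr hk)

end IsTonelliLagrangian

section PartialDerivatives

variable {n : ℕ} {L : E n × E n → ℝ}

lemma partialV_eq (hL : Differentiable ℝ L) (x v : E n) :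
    partialV n L x v = (fderiv ℝ L (x, v)).comp (ContinuousLinearMap.inr ℝ (E n) (E n)) := by
  have h := (hL (x, v)).hasFDerivAt.comp v (hasFDerivAt_prodMk_right (𝕜 := ℝ) x v)
  exact h.fderiv

lemma partialX_eq (hL : Differentiable ℝ L) (x v : E n) :
    partialX n L x v = (fderiv ℝ L (x, v)).comp (ContinuousLinearMap.inl ℝ (E n) (E n)) := by
  have h := (hL (x, v)).hasFDerivAt.comp x (hasFDerivAt_prodMk_left (𝕜 := ℝ) x v)
  exact h.fderiv

lemma fderiv_apply_eq_partial (hL : Differentiable ℝ L) (z w : E n × E n) :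
    fderiv ℝ L z w = partialX n L z.1 z.2 w.1 + partialV n L z.1 z.2 w.2 := by
  rw [partialV_eq hL, partialX_eq hL]
  simp [← map_add]

lemma contDiff_partialV (hL : ContDiff ℝ 2 L) :
    ContDiff ℝ 1 (fun z : E n × E n => partialV n L z.1 z.2) := by
  have h : (fun z : E n × E n => partialV n L z.1 z.2) =
      fun z => (fderiv ℝ L z).comp (ContinuousLinearMap.inr ℝ (E n) (E n)) := by
    ext1 z; rw [partialV_eq (hL.differentiable (by norm_num))]
  rw [h]
  exact (hL.fderiv_right (m := 1) (by norm_num)).clm_comp contDiff_const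

lemma contDiff_partialX (hL : ContDiff ℝ 2 L) :
    ContDiff ℝ 1 (fun z : E n × E n => partialX n L z.1 z.2) := by
  have h : (fun z : E n × E n => partialX n L z.1 z.2) =
      fun z => (fderiv ℝ L z).comp (ContinuousLinearMap.inl ℝ (E n) (E n)) := by
    ext1 z; rw [partialX_eq (hL.differentiable (by norm_num))]
  rw [h]
  exact (hL.fderiv_right (m := 1) (by norm_num)).clm_comp contDiff_const

/-- The fiberwise Hessian of `L`, as a quadratic form. -/
def fiberHessian (L : E n × E n → ℝ) (z : E n × E n) (w : E n) : ℝ :=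
  fderiv ℝ (fderiv ℝ L) z (0, w) (0, w)

lemma fiberHessian_smul (z : E n × E n) (a : ℝ) (w : E n) :
    fiberHessian L z (a • w) = a ^ 2 * fiberHessian L z w := by
  have : ((0 : E n), a • w) = a • ((0 : E n), w) := by simp
  simp only [fiberHessian, this, map_smul, _root_.smul_apply, smul_eq_mul]
  ring

@[simp] lemma fiberHessian_zero (z : E n × E n) : fiberHessian L z 0 = 0 := by
  simpa using fiberHessian_smul (L := L) z 0 0

lemma continuous_fiberHessian (hL : ContDiff ℝ 2 L) :
    Continuous (fun q : (E n × E n) × E n => fiberHessian L q.1 q.2) := by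
  have h : Continuous (fderiv ℝ (fderiv ℝ L)) :=
    (hL.fderiv_right (m := 1) (by norm_num)).continuous_fderiv (by norm_num)
  unfold fiberHessian
  fun_prop

lemma hasDerivAt_partialV_line (hL : ContDiff ℝ 2 L) (x v w : E n) (θ : ℝ) :
    HasDerivAt (fun θ : ℝ => partialV n L x (v + θ • w) w)
      (fiberHessian L (x, v + θ • w) w) θ := by
  have hd : Differentiable ℝ L := hL.differentiable (by norm_num)
  have h1 : HasDerivAt (fun θ : ℝ => (x, v + θ • w)) ((0 : E n), w) θ := by
    have h2 : HasDerivAt (fun θ : ℝ => v + θ • w) w θ := by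
      simpa using ((hasDerivAt_id θ).smul_const w).const_add v
    exact (hasDerivAt_const θ x).prodMk h2
  have h2 : HasFDerivAt (fderiv ℝ L) (fderiv ℝ (fderiv ℝ L) (x, v + θ • w)) (x, v + θ • w) :=
    ((hL.fderiv_right (m := 1) (by norm_num)).differentiable (by norm_num) _).hasFDerivAt
  have h3 : HasDerivAt (fun θ : ℝ => fderiv ℝ L (x, v + θ • w))
      (fderiv ℝ (fderiv ℝ L) (x, v + θ • w) (0, w)) θ := h2.comp_hasDerivAt θ h1
  have h4 : HasDerivAt (fun θ : ℝ => fderiv ℝ L (x, v + θ • w) (0, w))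
      (fderiv ℝ (fderiv ℝ L) (x, v + θ • w) (0, w) (0, w)) θ := by
    simpa using h3.clm_apply (hasDerivAt_const θ ((0 : E n), w))
  have h5 : (fun θ : ℝ => partialV n L x (v + θ • w) w) =
      fun θ : ℝ => fderiv ℝ L (x, v + θ • w) (0, w) := by
    ext1 s; rw [partialV_eq hd]; rfl
  rw [h5]
  exact h4

lemma hasDerivAt_line (hL : ContDiff ℝ 2 L) (x v w : E n) (θ : ℝ) :
    HasDerivAt (fun θ : ℝ => L (x, v + θ • w)) (partialV n L x (v + θ • w) w) θ := by
  have hd : Differentiable ℝ L := hL.differentiable (by norm_num)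
  have h1 : HasDerivAt (fun θ : ℝ => (x, v + θ • w)) ((0 : E n), w) θ := by
    have h2 : HasDerivAt (fun θ : ℝ => v + θ • w) w θ := by
      simpa using ((hasDerivAt_id θ).smul_const w).const_add v
    exact (hasDerivAt_const θ x).prodMk h2
  have h3 := (hd (x, v + θ • w)).hasFDerivAt.comp_hasDerivAt θ h1
  convert! h3 using 1
  simp [partialV_eq hd]

end PartialDerivatives

namespace IsTonelliLagrangian

variable {n : ℕ} {k : ℕ∞} {L : E n × E n → ℝ}

lemma fiberHessian_pos (hL : IsTonelliLagrangian n k L) (hk : 2 ≤ k) (z : E n × E n) {w : E n}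
    (hw : w ≠ 0) : 0 < fiberHessian L z w := by
  have h2 := hL.contDiff_two hk
  obtain ⟨x, v⟩ := z
  have h := hL.posdef x v w hw
  have h1 : DifferentiableAt ℝ (fun v' => partialV n L x v' w) v := by
    have : Differentiable ℝ (fun z : E n × E n => partialV n L z.1 z.2) :=
      (contDiff_partialV h2).differentiable (by norm_num)
    have h3 : Differentiable ℝ (fun v' : E n => partialV n L x v') :=
      this.comp (g := fun z : E n × E n => partialV n L z.1 z.2) (f := fun v' => (x, v'))
        (by fun_prop)
    exact (h3 v).clm_apply (differentiableAt_const w)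
  have h4 : HasDerivAt (fun θ : ℝ => v + θ • w) w 0 := by
    simpa using ((hasDerivAt_id (0 : ℝ)).smul_const w).const_add v
  have h1' : HasFDerivAt (fun v' => partialV n L x v' w)
      (fderiv ℝ (fun v' => partialV n L x v' w) v) (v + (0 : ℝ) • w) := by
    simpa using h1.hasFDerivAt
  have h5 := h1'.comp_hasDerivAt 0 h4
  have h6 := h5.unique (hasDerivAt_partialV_line h2 x v w 0)
  simp only [zero_smul, add_zero] at h6
  rw [← h6]
  exact h

lemma fiberHessian_nonneg (hL : IsTonelliLagrangian n k L) (hk : 2 ≤ k) (z : E n × E n) (w : E n) :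
    0 ≤ fiberHessian L z w := by
  rcases eq_or_ne w 0 with rfl | hw
  · simp
  · exact (hL.fiberHessian_pos hk z hw).le

/-- The graph of `L` restricted to a fiber lies above its tangent planes. -/
lemma tangent_le (hL : IsTonelliLagrangian n k L) (hk : 2 ≤ k) (x v w : E n) :
    L (x, v) + partialV n L x v (w - v) ≤ L (x, w) := by
  have h2 := hL.contDiff_two hk
  have hmono : Monotone (fun θ : ℝ => partialV n L x (v + θ • (w - v)) (w - v)) :=
    monotone_of_hasDerivAt_nonneg (hasDerivAt_partialV_line h2 x v (w - v))
      (fun θ => hL.fiberHessian_nonneg hk _ _)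
  obtain ⟨θ, hθ, h⟩ := exists_hasDerivAt_eq_slope (fun θ : ℝ => L (x, v + θ • (w - v)))
    (fun θ => partialV n L x (v + θ • (w - v)) (w - v)) zero_lt_one
    (fun θ _ => (hasDerivAt_line h2 x v (w - v) θ).continuousAt.continuousWithinAt)
    (fun θ _ => hasDerivAt_line h2 x v (w - v) θ)
  have h3 := hmono hθ.1.le
  simp only [zero_smul, one_smul, add_zero, sub_zero, div_one, add_sub_cancel] at h h3
  linarith

/-- Over a bounded convex region the fiberwise Hessian is uniformly positive definite. -/
lemma exists_le_fiberHessian (hL : IsTonelliLagrangian n k L) (hk : 2 ≤ k) {K : Set (E n × E n)}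
    (hK : IsCompact K) :
    ∃ α : ℝ, 0 < α ∧ ∀ z ∈ K, ∀ w : E n, α * ‖w‖ ^ 2 ≤ fiberHessian L z w := by
  have h2 := hL.contDiff_two hk
  obtain ⟨α, hα, h⟩ := (hK.prod (isCompact_sphere (0 : E n) 1)).exists_forall_le'
    (continuous_fiberHessian h2).continuousOn (a := 0) (fun q hq => hL.fiberHessian_pos hk _ (by
      rintro h0
      have := hq.2
      simp [h0] at this))
  refine ⟨α, hα, fun z hz w => ?_⟩
  rcases eq_or_ne w 0 with rfl | hw
  · simp
  have hw' : ‖w‖ ≠ 0 := norm_ne_zero_iff.mpr hw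
  have h3 := h (z, ‖w‖⁻¹ • w) ⟨hz, by simp [norm_smul, hw']⟩
  have h4 : w = ‖w‖ • (‖w‖⁻¹ • w) := by simp [smul_smul, hw']
  conv_rhs => rw [h4, fiberHessian_smul]
  nlinarith [sq_nonneg ‖w‖]

lemma exists_abs_le (hL : IsTonelliLagrangian n k L) (R : ℝ) :
    ∃ B : ℝ, ∀ x v : E n, ‖v‖ ≤ R → |L (x, v)| ≤ B := by
  obtain ⟨B, hB⟩ := ((isCompact_closedBall (0 : E n) 1).prod
    (isCompact_closedBall (0 : E n) R)).exists_bound_of_continuousOn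
      hL.smooth.continuous.continuousOn
  refine ⟨B, fun x v hv => ?_⟩
  have hx : x = (fun i => Int.fract (x i)) + intVec (fun i => ⌊x i⌋) := by
    ext i; simp [intVec, Int.fract_add_floor]
  rw [hx, hL.periodic]
  refine hB (_, v) ⟨?_, by simpa using hv⟩
  simp only [mem_closedBall_zero_iff]
  refine (pi_norm_le_iff_of_nonneg zero_le_one).mpr fun i => ?_
  rw [Real.norm_of_nonneg (Int.fract_nonneg _)]
  exact (Int.fract_lt_one _).le

lemma exists_neg_le (hL : IsTonelliLagrangian n k L) :
    ∃ B : ℝ, 0 ≤ B ∧ ∀ z : E n × E n, -B ≤ L z := by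
  obtain ⟨R, hR⟩ := hL.superlinear 0
  obtain ⟨B, hB⟩ := hL.exists_abs_le R
  refine ⟨|B|, abs_nonneg _, fun ⟨x, v⟩ => ?_⟩
  rcases le_total R ‖v‖ with h | h
  · have := hR x v h
    have := abs_nonneg B
    linarith
  · have := (abs_le.mp (hB x v h)).1
    have := le_abs_self B
    linarith

end IsTonelliLagrangian

section Uniqueness

variable {n : ℕ} {k : ℕ∞} {L : E n × E n → ℝ}

lemma ContDiff.exists_norm_sub_le_of_closedBall {V W : Type*} [NormedAddCommGroup V]
    [NormedSpace ℝ V] [FiniteDimensional ℝ V] [NormedAddCommGroup W] [NormedSpace ℝ W]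
    {f : V → W} (hf : ContDiff ℝ 1 f) (R : ℝ) :
    ∃ Λ : ℝ, 0 ≤ Λ ∧ ∀ x ∈ Metric.closedBall (0 : V) R, ∀ y ∈ Metric.closedBall (0 : V) R,
      ‖f x - f y‖ ≤ Λ * ‖x - y‖ := by
  have := FiniteDimensional.proper ℝ V
  obtain ⟨Λ, hΛ⟩ := (isCompact_closedBall (0 : V) R).exists_bound_of_continuousOn
    (hf.continuous_fderiv (by norm_num)).continuousOn
  refine ⟨|Λ|, abs_nonneg _, fun x hx y hy => ?_⟩
  exact (convex_closedBall (0 : V) R).norm_image_sub_le_of_norm_fderiv_le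
    (fun z _ => hf.differentiable (by norm_num) z)
    (fun z hz => (hΛ z hz).trans (le_abs_self _)) hy hx

/-- On bounded sets, the Legendre transform has a Lipschitz inverse. -/
lemma IsTonelliLagrangian.exists_norm_sub_le (hL : IsTonelliLagrangian n k L) (hk : 2 ≤ k)
    (R : ℝ) :
    ∃ C : ℝ, 0 ≤ C ∧ ∀ z₁ ∈ Metric.closedBall (0 : E n × E n) R,
      ∀ z₂ ∈ Metric.closedBall (0 : E n × E n) R, ‖z₁.2 - z₂.2‖ ≤
        C * (‖z₁.1 - z₂.1‖ + ‖partialV n L z₁.1 z₁.2 - partialV n L z₂.1 z₂.2‖) := by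
  have h2 := hL.contDiff_two hk
  obtain ⟨α, hα, hH⟩ := hL.exists_le_fiberHessian hk (isCompact_closedBall (0 : E n × E n) R)
  obtain ⟨Λ, hΛ, hlip⟩ := (contDiff_partialV h2).exists_norm_sub_le_of_closedBall R
  refine ⟨(Λ + 1) / α, by positivity, ?_⟩
  rintro ⟨x₁, v₁⟩ hz₁ ⟨x₂, v₂⟩ hz₂
  have hz : (x₁, v₂) ∈ Metric.closedBall (0 : E n × E n) R := by
    simp only [mem_closedBall_zero_iff, Prod.norm_mk, max_le_iff] at hz₁ hz₂ ⊢
    exact ⟨hz₁.1, hz₂.2⟩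
  set w := v₁ - v₂ with hw
  obtain ⟨θ, hθ, h⟩ := exists_hasDerivAt_eq_slope (fun θ : ℝ => partialV n L x₁ (v₂ + θ • w) w)
    (fun θ => fiberHessian L (x₁, v₂ + θ • w) w) zero_lt_one
    (fun θ _ => (hasDerivAt_partialV_line h2 x₁ v₂ w θ).continuousAt.continuousWithinAt)
    (fun θ _ => hasDerivAt_partialV_line h2 x₁ v₂ w θ)
  have hmem : (x₁, v₂ + θ • w) ∈ Metric.closedBall (0 : E n × E n) R := by
    have := (convex_closedBall (0 : E n × E n) R).add_smul_sub_mem hz hz₁ ⟨hθ.1.le, hθ.2.le⟩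
    simpa [hw] using this
  have h3 := hH _ hmem w
  simp only [zero_smul, one_smul, add_zero, sub_zero, div_one] at h
  rw [h, show v₂ + w = v₁ by simp [hw], ← sub_apply] at h3
  have h4 : (partialV n L x₁ v₁ - partialV n L x₁ v₂) w ≤
      ‖partialV n L x₁ v₁ - partialV n L x₁ v₂‖ * ‖w‖ :=
    (Real.le_norm_self _).trans (ContinuousLinearMap.le_opNorm _ _)
  have h5 : ‖partialV n L x₁ v₁ - partialV n L x₁ v₂‖ ≤
      ‖partialV n L x₁ v₁ - partialV n L x₂ v₂‖ + Λ * ‖x₁ - x₂‖ := by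
    have h6 := hlip _ hz₂ _ hz
    have h7 : ‖((x₂, v₂) : E n × E n) - (x₁, v₂)‖ = ‖x₁ - x₂‖ := by
      simp [Prod.norm_mk, norm_sub_rev]
    rw [h7] at h6
    calc _ = ‖(partialV n L x₁ v₁ - partialV n L x₂ v₂) +
          (partialV n L x₂ v₂ - partialV n L x₁ v₂)‖ := by congr 1; abel
      _ ≤ _ := (norm_add_le _ _).trans (by gcongr)
  have h8 : α * ‖w‖ ≤ ‖partialV n L x₁ v₁ - partialV n L x₁ v₂‖ := by
    rcases eq_or_lt_of_le (norm_nonneg w) with h0 | h0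
    · rw [← h0]; simp
    · refine le_of_mul_le_mul_right ?_ h0
      nlinarith
  simp only
  rw [div_mul_eq_mul_div, le_div_iff₀ hα]
  nlinarith [norm_nonneg (x₁ - x₂), norm_nonneg (partialV n L x₁ v₁ - partialV n L x₂ v₂)]

lemma IsExtremal.hasDerivAt {γ : ℝ → E n} (h : IsExtremal n L γ) (t : ℝ) :
    HasDerivAt γ (deriv γ t) t :=
  (h.1.differentiable (by norm_num) t).hasDerivAt

lemma IsExtremal.contDiff_deriv {γ : ℝ → E n} (h : IsExtremal n L γ) :
    ContDiff ℝ 1 (deriv γ) :=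
  ((contDiff_succ_iff_deriv (n := 1)).mp (by simpa [one_add_one_eq_two] using h.1)).2.2

lemma IsExtremal.eq_of_nonneg {γ₁ γ₂ : ℝ → E n} (hL : IsTonelliLagrangian n k L) (hk : 2 ≤ k)
    (h₁ : IsExtremal n L γ₁) (h₂ : IsExtremal n L γ₂) (h0 : γ₁ 0 = γ₂ 0)
    (h0' : deriv γ₁ 0 = deriv γ₂ 0) {T : ℝ} (hT : 0 ≤ T) : γ₁ T = γ₂ T := by
  have h2 := hL.contDiff_two hk
  have hc₁ : Continuous fun t => (γ₁ t, deriv γ₁ t) :=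
    h₁.1.continuous.prodMk h₁.contDiff_deriv.continuous
  have hc₂ : Continuous fun t => (γ₂ t, deriv γ₂ t) :=
    h₂.1.continuous.prodMk h₂.contDiff_deriv.continuous
  obtain ⟨R₁, hR₁⟩ := (isCompact_Icc (a := 0) (b := T)).exists_bound_of_continuousOn
    hc₁.continuousOn
  obtain ⟨R₂, hR₂⟩ := (isCompact_Icc (a := 0) (b := T)).exists_bound_of_continuousOn
    hc₂.continuousOn
  set R := max R₁ R₂
  obtain ⟨C, hC, hleg⟩ := hL.exists_norm_sub_le hk R
  obtain ⟨Λ, hΛ, hlip⟩ := (contDiff_partialX h2).exists_norm_sub_le_of_closedBall R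
  set p₁ : ℝ → E n →L[ℝ] ℝ := fun s => partialV n L (γ₁ s) (deriv γ₁ s)
  set p₂ : ℝ → E n →L[ℝ] ℝ := fun s => partialV n L (γ₂ s) (deriv γ₂ s)
  set f : ℝ → E n × (E n →L[ℝ] ℝ) := fun t => (γ₁ t - γ₂ t, p₁ t - p₂ t)
  set f' : ℝ → E n × (E n →L[ℝ] ℝ) := fun t => (deriv γ₁ t - deriv γ₂ t,
    partialX n L (γ₁ t) (deriv γ₁ t) - partialX n L (γ₂ t) (deriv γ₂ t))
  have hf : ∀ t, HasDerivAt f (f' t) t := fun t =>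
    ((h₁.hasDerivAt t).sub (h₂.hasDerivAt t)).prodMk ((h₁.2 t).sub (h₂.2 t))
  have hbound : ∀ t ∈ Set.Ico 0 T, ‖f' t‖ ≤ ((1 + Λ) * (2 * C + 1)) * ‖f t‖ + 0 := by
    intro t ht
    have ht' : t ∈ Set.Icc 0 T := ⟨ht.1, ht.2.le⟩
    have hm₁ : (γ₁ t, deriv γ₁ t) ∈ Metric.closedBall (0 : E n × E n) R :=
      mem_closedBall_zero_iff.mpr ((hR₁ t ht').trans (le_max_left _ _))
    have hm₂ : (γ₂ t, deriv γ₂ t) ∈ Metric.closedBall (0 : E n × E n) R :=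
      mem_closedBall_zero_iff.mpr ((hR₂ t ht').trans (le_max_right _ _))
    have e1 : ‖γ₁ t - γ₂ t‖ ≤ ‖f t‖ := norm_fst_le (f t)
    have e2 : ‖p₁ t - p₂ t‖ ≤ ‖f t‖ := norm_snd_le (f t)
    have e3 := hleg _ hm₁ _ hm₂
    have e4 := hlip _ hm₁ _ hm₂
    simp only [Prod.mk_sub_mk, Prod.norm_mk] at e3 e4
    have e5 : ‖deriv γ₁ t - deriv γ₂ t‖ ≤ (2 * C + 1) * ‖f t‖ := by
      have : C * (‖γ₁ t - γ₂ t‖ + ‖p₁ t - p₂ t‖) ≤ C * (‖f t‖ + ‖f t‖) := by gcongr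
      nlinarith [norm_nonneg (f t)]
    have e6 : max ‖γ₁ t - γ₂ t‖ ‖deriv γ₁ t - deriv γ₂ t‖ ≤ (2 * C + 1) * ‖f t‖ :=
      max_le (by nlinarith [norm_nonneg (f t), mul_nonneg hC (norm_nonneg (f t))]) e5
    have e7 := e4.trans (mul_le_mul_of_nonneg_left e6 hΛ)
    have e8 : 0 ≤ (2 * C + 1) * ‖f t‖ := by positivity
    rw [add_zero, Prod.norm_def]
    refine max_le ?_ ?_
    · change ‖deriv γ₁ t - deriv γ₂ t‖ ≤ _
      nlinarith [mul_nonneg hΛ e8]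
    · change ‖partialX n L (γ₁ t) (deriv γ₁ t) - partialX n L (γ₂ t) (deriv γ₂ t)‖ ≤ _
      nlinarith
  have h3 := norm_le_gronwallBound_of_norm_deriv_right_le
    (fun t _ => (hf t).continuousAt.continuousWithinAt)
    (fun t _ => (hf t).hasDerivWithinAt) (δ := 0) (by simp [f, p₁, p₂, h0, h0']) hbound T
    ⟨hT, le_rfl⟩
  rw [gronwallBound_ε0_δ0] at h3
  have h4 : f T = 0 := norm_le_zero_iff.mp h3
  exact sub_eq_zero.mp (congrArg Prod.fst h4)

end Uniqueness

section Lifting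

open Set Filter Topology

/-- Path lifting for a local homeomorphism, provided that all partial lifts stay in a fixed
compact set. -/
lemma exists_path_lift {X Y : Type*} [TopologicalSpace X] [TopologicalSpace Y] [T2Space Y]
    {P : X → Y} (hPc : Continuous P) {K : Set X} (hK : IsCompact K)
    (hP : ∀ x ∈ K, ∃ f : OpenPartialHomeomorph X Y, x ∈ f.source ∧ ⇑f = P)
    {γ : ℝ → Y} (hγ : Continuous γ) {a b : ℝ} (hab : a ≤ b) {x₀ : X} (h0 : P x₀ = γ a)
    (hbd : ∀ T ∈ Icc a b, ∀ u : ℝ → X, ContinuousOn u (Icc a T) → u a = x₀ →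
      (∀ s ∈ Icc a T, P (u s) = γ s) → u T ∈ K) :
    ∃ u : ℝ → X, ContinuousOn u (Icc a b) ∧ u a = x₀ ∧ ∀ s ∈ Icc a b, P (u s) = γ s := by
  let Lift : ℝ → (ℝ → X) → Prop := fun T u =>
    ContinuousOn u (Icc a T) ∧ u a = x₀ ∧ ∀ s ∈ Icc a T, P (u s) = γ s
  have key : ∀ T₀ : ℝ, ∀ᶠ q : ℝ × ℝ in 𝓝 (T₀, T₀), ∀ x ∈ K, a ≤ q.1 →
      ∀ u, Lift q.1 u → u q.1 = x → ∃ u', Lift q.2 u' := by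
    intro T₀
    refine hK.eventually_forall_of_forall_eventually fun x hx => ?_
    obtain ⟨f, hxf, rfl⟩ := hP x hx
    by_cases hfx : f x = γ T₀
    · have h1 : ∀ᶠ s in 𝓝 T₀, γ s ∈ f.target :=
        hγ.continuousAt.eventually (f.open_target.mem_nhds (hfx ▸ f.map_source hxf))
      obtain ⟨δ, hδ, hball⟩ := Metric.eventually_nhds_iff_ball.mp h1
      have h2 : ∀ᶠ q : (ℝ × ℝ) × X in 𝓝 ((T₀, T₀), x), q.1.1 ∈ Metric.ball T₀ δ ∧
          q.1.2 ∈ Metric.ball T₀ δ ∧ q.2 ∈ f.source := by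
        exact ((Metric.isOpen_ball.preimage continuous_fst.fst).inter
          ((Metric.isOpen_ball.preimage continuous_fst.snd).inter
          (f.open_source.preimage continuous_snd))).mem_nhds
          ⟨Metric.mem_ball_self hδ, Metric.mem_ball_self hδ, hxf⟩
      filter_upwards [h2]
      rintro ⟨⟨T, T'⟩, y⟩ ⟨hT, hT', hy⟩ haT u ⟨hu, hu0, hul⟩ huT
      simp only at hT hT' hy haT hu hul huT ⊢
      rcases le_total T' T with hTT | hTT
      · exact ⟨u, hu.mono (Icc_subset_Icc_right hTT), hu0,
          fun s hs => hul s ⟨hs.1, hs.2.trans hTT⟩⟩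
      have hsub : ∀ s ∈ Icc T T', γ s ∈ f.target := fun s hs =>
        hball s ((convex_ball T₀ δ).ordConnected.out hT hT' hs)
      have hglue : f.symm (γ T) = u T := by
        rw [← hul T ⟨haT, le_rfl⟩]
        exact f.left_inv (huT ▸ hy)
      refine ⟨fun s => if s ≤ T then u s else f.symm (γ s), ?_, by simp [haT, hu0], ?_⟩
      · have hunion : Icc a T' = Icc a T ∪ Icc T T' := (Icc_union_Icc_eq_Icc haT hTT).symm
        rw [hunion]
        refine ContinuousOn.union_of_isClosed ?_ ?_ isClosed_Icc isClosed_Icc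
        · exact hu.congr fun s hs => if_pos hs.2
        · refine ContinuousOn.congr (f := fun s => f.symm (γ s)) ?_ ?_
          · exact f.continuousOn_symm.comp hγ.continuousOn hsub
          · intro s hs
            rcases eq_or_lt_of_le hs.1 with rfl | h
            · simp [hglue]
            · simp [not_le.mpr h]
      · intro s hs
        by_cases h : s ≤ T
        · simpa [h] using hul s ⟨hs.1, h⟩
        · simpa [h] using f.right_inv (hsub s ⟨(not_le.mp h).le, hs.2⟩)
    · obtain ⟨U, V, hU, hV, hxU, hxV, hUV⟩ := t2_separation hfx
      have h2 : ∀ᶠ q : (ℝ × ℝ) × X in 𝓝 ((T₀, T₀), x), γ q.1.1 ∈ V ∧ f q.2 ∈ U := by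
        exact ((hV.preimage (hγ.comp continuous_fst.fst)).inter
          (hU.preimage (hPc.comp continuous_snd))).mem_nhds ⟨hxV, hxU⟩
      filter_upwards [h2]
      rintro ⟨⟨T, T'⟩, y⟩ ⟨hT, hy⟩ haT u ⟨hu, hu0, hul⟩ huT
      simp only at hT hy haT hul huT
      refine absurd ?_ (Set.disjoint_left.mp hUV hy)
      rw [← huT, hul T ⟨haT, le_rfl⟩]
      exact hT
  have hind := isPreconnected_Icc.induction₂ (s := Icc a b)
    (fun T T' => (∃ u, Lift T u) ↔ ∃ u, Lift T' u) (fun T hT => ?_)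
    (fun _ _ _ _ _ _ h h' => h.trans h') (fun _ _ _ _ h => h.symm)
    (left_mem_Icc.mpr hab) (right_mem_Icc.mpr hab)
  · refine hind.mp ⟨fun _ => x₀, continuousOn_const, rfl, fun s hs => ?_⟩
    rw [h0, le_antisymm hs.2 hs.1]
  · have e1 := (Continuous.prodMk_right T).continuousAt.eventually (key T)
    have e2 := (Continuous.prodMk_left T).continuousAt.eventually (key T)
    filter_upwards [e1.filter_mono nhdsWithin_le_nhds, e2.filter_mono nhdsWithin_le_nhds,
      self_mem_nhdsWithin] with T' h1 h2 hT'
    constructor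
    · rintro ⟨u, hu⟩
      exact h1 _ (hbd T hT u hu.1 hu.2.1 hu.2.2) hT.1 u hu rfl
    · rintro ⟨u, hu⟩
      exact h2 _ (hbd T' hT' u hu.1 hu.2.1 hu.2.2) hT'.1 u hu rfl

end Lifting

section FiberedMaps

open Set Filter Topology Asymptotics

/-- Along a homotopy with fixed endpoint, lifts through a local homeomorphism
end at a fixed point. -/
lemma IsLocalHomeomorph.lift_end_eq {X Y : Type*} [TopologicalSpace X] [TopologicalSpace Y]
    [T2Space X] {P : X → Y} (hP : IsLocalHomeomorph P) {H : ℝ × ℝ → Y} (hH : Continuous H)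
    {a b : ℝ} (hab : a ≤ b) {u : ℝ → ℝ → X} (hu : ∀ τ, ContinuousOn (u τ) (Icc a b))
    {x₀ : X} (ha : ∀ τ, u τ a = x₀) (hl : ∀ τ, ∀ s ∈ Icc a b, P (u τ s) = H (s, τ))
    {y : Y} (hb : ∀ τ, H (b, τ) = y) (τ τ' : ℝ) : u τ b = u τ' b := by
  have hmem : ∀ θ : unitInterval, a + θ * (b - a) ∈ Icc a b := fun θ =>
    ⟨by nlinarith [θ.2.1], by nlinarith [θ.2.2]⟩
  let f : C(unitInterval × ℝ, Y) := ⟨fun q => H (a + q.1 * (b - a), q.2), by fun_prop⟩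
  have hg : Continuous (fun q : unitInterval × ℝ => u q.2 (a + q.1 * (b - a))) := by
    refine hP.continuous_lift (T2Space.isSeparatedMap P) f ?_ ?_ ?_
    · ext q; exact hl q.2 _ (hmem q.1)
    · simp only [Icc.coe_zero, zero_mul, add_zero, ha]; exact continuous_const
    · intro τ
      exact (hu τ).comp_continuous (by fun_prop) hmem
  have h1 : Continuous (fun τ => u τ b) := by
    have := hg.comp (Continuous.prodMk_right (1 : unitInterval))
    simpa [Function.comp_def] using this
  refine (T2Space.isSeparatedMap P).const_of_comp hP.isLocallyInjective
    h1 (fun t t' => ?_) τ τ'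
  rw [hl t b (right_mem_Icc.mpr hab), hl t' b (right_mem_Icc.mpr hab), hb, hb]

variable {V : Type*} [NormedAddCommGroup V] [NormedSpace ℝ V] [FiniteDimensional ℝ V]

lemma exists_equiv_hasStrictFDerivAt {e : ℝ × V → V} (he : ContDiff ℝ 1 e) {q : ℝ × V}
    (hinj : ∀ w : V, fderiv ℝ e q (0, w) = 0 → w = 0) :
    ∃ A : (ℝ × V) ≃L[ℝ] ℝ × V,
      HasStrictFDerivAt (fun q : ℝ × V => (q.1, e q)) (A : (ℝ × V) →L[ℝ] ℝ × V) q := by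
  let Q' : (ℝ × V) →L[ℝ] ℝ × V := (ContinuousLinearMap.fst ℝ ℝ V).prod (fderiv ℝ e q)
  have hQ' : Function.Injective (Q' : (ℝ × V) →ₗ[ℝ] ℝ × V) := by
    refine (injective_iff_map_eq_zero _).mpr ?_
    rintro ⟨s, w⟩ h
    have h1 : s = 0 := congrArg Prod.fst h
    subst h1
    have h2 : fderiv ℝ e q (0, w) = 0 := congrArg Prod.snd h
    rw [hinj w h2]; rfl
  refine ⟨(LinearEquiv.ofInjectiveEndo _ hQ').toContinuousLinearEquiv, ?_⟩
  have h1 : HasStrictFDerivAt (fun q : ℝ × V => (q.1, e q)) Q' q :=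
    hasStrictFDerivAt_fst.prodMk (he.contDiffAt.hasStrictFDerivAt (by norm_num))
  exact h1

lemma exists_openPartialHomeomorph {e : ℝ × V → V} (he : ContDiff ℝ 1 e) {q : ℝ × V}
    (hinj : ∀ w : V, fderiv ℝ e q (0, w) = 0 → w = 0) :
    ∃ f : OpenPartialHomeomorph (ℝ × V) (ℝ × V), q ∈ f.source ∧
      ⇑f = fun q : ℝ × V => (q.1, e q) := by
  obtain ⟨A, hA⟩ := exists_equiv_hasStrictFDerivAt he hinj
  have := FiniteDimensional.complete ℝ (ℝ × V)
  exact ⟨hA.toOpenPartialHomeomorph _, hA.mem_toOpenPartialHomeomorph_source, rfl⟩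

lemma isBigO_sub_of_fderiv_injective {e : ℝ × V → V} (he : ContDiff ℝ 1 e) {q : ℝ × V}
    (hinj : ∀ w : V, fderiv ℝ e q (0, w) = 0 → w = 0) :
    (fun q' => q' - q) =O[𝓝 q] fun q' => (q'.1 - q.1, e q' - e q) := by
  obtain ⟨A, hA⟩ := exists_equiv_hasStrictFDerivAt he hinj
  exact (hA.hasFDerivAt.isTheta_sub A.toHomeomorph.isInducing).2

end FiberedMaps

section Flow

open Set Filter Topology Asymptotics

variable {n : ℕ} {L : E n × E n → ℝ} {φ : ℝ → E n × E n → E n × E n}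

/-- Position at time `q.1` of the extremal starting from `x₀` with velocity `q.2`. -/
def flowPos (φ : ℝ → E n × E n → E n × E n) (x₀ : E n) (q : ℝ × E n) : E n :=
  (φ q.1 (x₀, q.2)).1

/-- Velocity at time `q.1` of the extremal starting from `x₀` with velocity `q.2`. -/
def flowVel (φ : ℝ → E n × E n → E n × E n) (x₀ : E n) (q : ℝ × E n) : E n :=
  (φ q.1 (x₀, q.2)).2

/-- Momentum at time `q.1` of the extremal starting from `x₀` with velocity `q.2`. -/
def flowMom (L : E n × E n → ℝ) (φ : ℝ → E n × E n → E n × E n) (x₀ : E n) (q : ℝ × E n) :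
    E n →L[ℝ] ℝ :=
  partialV n L (flowPos φ x₀ q) (flowVel φ x₀ q)

/-- Action on `[0, q.1]` of the extremal starting from `x₀` with velocity `q.2`. -/
def flowAction (L : E n × E n → ℝ) (φ : ℝ → E n × E n → E n × E n) (x₀ : E n) (q : ℝ × E n) :
    ℝ :=
  ∫ r in (0 : ℝ)..q.1, L (φ r (x₀, q.2))

namespace IsELFlow

variable {k : ℕ} (x₀ : E n)

lemma contDiff_one (hφ : IsELFlow n k L φ) (hk : 2 ≤ k) :
    ContDiff ℝ 1 (fun p : ℝ × (E n × E n) => φ p.1 p.2) := by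
  refine hφ.1.of_le ?_
  rw [show (1 : WithTop ℕ∞) = (((1 : ℕ) : ℕ∞) : WithTop ℕ∞) from rfl]
  exact_mod_cast (by omega : 1 ≤ k - 1)

lemma contDiff_flow (hφ : IsELFlow n k L φ) (hk : 2 ≤ k) :
    ContDiff ℝ 1 (fun q : ℝ × E n => φ q.1 (x₀, q.2)) :=
  (hφ.contDiff_one hk).comp (f := fun q : ℝ × E n => (q.1, (x₀, q.2))) (by fun_prop)

lemma contDiff_flowPos (hφ : IsELFlow n k L φ) (hk : 2 ≤ k) : ContDiff ℝ 1 (flowPos φ x₀) :=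
  (hφ.contDiff_flow x₀ hk).fst

lemma contDiff_flowVel (hφ : IsELFlow n k L φ) (hk : 2 ≤ k) : ContDiff ℝ 1 (flowVel φ x₀) :=
  (hφ.contDiff_flow x₀ hk).snd

lemma isExtremal (hφ : IsELFlow n k L φ) (u : E n) :
    IsExtremal n L (fun r => flowPos φ x₀ (r, u)) := (hφ.2.2 x₀ u).1

lemma deriv_flowPos (hφ : IsELFlow n k L φ) (u : E n) (r : ℝ) :
    deriv (fun r => flowPos φ x₀ (r, u)) r = flowVel φ x₀ (r, u) := ((hφ.2.2 x₀ u).2 r).symm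

lemma hasDerivAt_flowPos (hφ : IsELFlow n k L φ) (u : E n) (r : ℝ) :
    HasDerivAt (fun r => flowPos φ x₀ (r, u)) (flowVel φ x₀ (r, u)) r := by
  rw [← hφ.deriv_flowPos]
  exact (hφ.isExtremal x₀ u).hasDerivAt r

lemma hasDerivAt_flowMom (hφ : IsELFlow n k L φ) (u : E n) (r : ℝ) :
    HasDerivAt (fun r => flowMom L φ x₀ (r, u))
      (partialX n L (flowPos φ x₀ (r, u)) (flowVel φ x₀ (r, u))) r := by
  have h := (hφ.isExtremal x₀ u).2 r
  simp only [hφ.deriv_flowPos] at h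
  exact h

lemma flowPos_zero (hφ : IsELFlow n k L φ) (u : E n) : flowPos φ x₀ (0, u) = x₀ := by
  simp [flowPos, hφ.2.1]

lemma flowVel_zero (hφ : IsELFlow n k L φ) (u : E n) : flowVel φ x₀ (0, u) = u := by
  simp [flowVel, hφ.2.1]

lemma fderiv_flowPos_injective (hφ : IsELFlow n k L φ) (hk : 2 ≤ k)
    (hnc : NoConjugatePoints n φ) {q : ℝ × E n} (hq : q.1 ≠ 0) (w : E n)
    (h : fderiv ℝ (flowPos φ x₀) q (0, w) = 0) : w = 0 := by
  obtain ⟨r, u⟩ := q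
  refine hnc (x₀, u) r hq w ?_
  have h1 : DifferentiableAt ℝ (φ r) (x₀, u) :=
    (((hφ.contDiff_one hk).comp (f := fun z : E n × E n => (r, z))
      (by fun_prop)).differentiable (by norm_num)) _
  have h2 : HasFDerivAt (fun v : E n => φ r (x₀, v))
      ((fderiv ℝ (φ r) (x₀, u)).comp (ContinuousLinearMap.inr ℝ (E n) (E n))) u :=
    h1.hasFDerivAt.comp u (hasFDerivAt_prodMk_right (𝕜 := ℝ) x₀ u)
  have h3 : HasFDerivAt (fun v : E n => flowPos φ x₀ (r, v))
      ((fderiv ℝ (flowPos φ x₀) (r, u)).comp (ContinuousLinearMap.inr ℝ ℝ (E n))) u :=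
    ((hφ.contDiff_flowPos x₀ hk).differentiable (by norm_num) _).hasFDerivAt.comp u
      (hasFDerivAt_prodMk_right (𝕜 := ℝ) r u)
  have h4 := congrArg (fun A => A w) (h2.fst.unique h3)
  have h5 : (fderiv ℝ (φ r) (x₀, u) (0, w)).1 = fderiv ℝ (flowPos φ x₀) (r, u) (0, w) := by
    simpa using h4
  exact h5.trans h

lemma continuous_lagrangian (hφ : IsELFlow n k L φ) (hk : 2 ≤ k) (hL : ContDiff ℝ 2 L) :
    Continuous (fun q : ℝ × E n => L (φ q.1 (x₀, q.2))) :=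
  hL.continuous.comp (hφ.contDiff_flow x₀ hk).continuous

lemma continuous_flowAction (hφ : IsELFlow n k L φ) (hk : 2 ≤ k) (hL : ContDiff ℝ 2 L) :
    Continuous (flowAction L φ x₀) := by
  refine intervalIntegral.continuous_parametric_intervalIntegral_of_continuous
    (f := fun (q : ℝ × E n) r => L (φ r (x₀, q.2))) ?_ continuous_fst
  exact (hφ.continuous_lagrangian x₀ hk hL).comp
    (f := fun p : (ℝ × E n) × ℝ => (p.2, p.1.2)) (by fun_prop)

lemma hasDerivAt_flowAction (hφ : IsELFlow n k L φ) (hk : 2 ≤ k) (hL : ContDiff ℝ 2 L) (u : E n)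
    (r : ℝ) : HasDerivAt (fun r => flowAction L φ x₀ (r, u)) (L (φ r (x₀, u))) r := by
  have h : Continuous (fun r => L (φ r (x₀, u))) :=
    (hφ.continuous_lagrangian x₀ hk hL).comp (Continuous.prodMk_left u)
  exact h.integral_hasStrictDerivAt 0 r |>.hasDerivAt

/-- First variation of the action with respect to the initial velocity, at fixed time. -/
lemma flowAction_fixed_time (hφ : IsELFlow n k L φ) (hk : 2 ≤ k) (hL : ContDiff ℝ 2 L)
    (r₁ : ℝ) (u₁ : E n) {ε : ℝ} (hε : 0 < ε) :
    ∀ᶠ u in 𝓝 u₁, |flowAction L φ x₀ (r₁, u) - flowAction L φ x₀ (r₁, u₁) -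
      flowMom L φ x₀ (r₁, u₁) (flowPos φ x₀ (r₁, u) - flowPos φ x₀ (r₁, u₁))| ≤
        ε * ‖u - u₁‖ * |r₁| := by
  have hd : Differentiable ℝ L := hL.differentiable (by norm_num)
  let Z : ℝ × E n → E n × E n := fun q => φ q.1 (x₀, q.2)
  have hZ : ContDiff ℝ 1 Z := hφ.contDiff_flow x₀ hk
  have hDL : Continuous (fderiv ℝ L) := hL.continuous_fderiv (by norm_num)
  let D : E n → ℝ → E n →L[ℝ] ℝ := fun u r =>
    ((fderiv ℝ L (Z (r, u)) - fderiv ℝ L (Z (r, u₁))).comp (fderiv ℝ Z (r, u))).comp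
      (ContinuousLinearMap.inr ℝ ℝ (E n))
  have hDc : Continuous (fun q : E n × ℝ => D q.1 q.2) := by
    have hZc := hZ.continuous
    have hZd := hZ.continuous_fderiv (by norm_num)
    have h1 : Continuous fun q : E n × ℝ => fderiv ℝ L (Z (q.2, q.1)) := by fun_prop
    have h2 : Continuous fun q : E n × ℝ => fderiv ℝ L (Z (q.2, u₁)) := by fun_prop
    have h3 : Continuous fun q : E n × ℝ => fderiv ℝ Z (q.2, q.1) := by fun_prop
    exact ((h1.sub h2).clm_comp h3).clm_comp continuous_const
  have hψ : ∀ r u, HasFDerivAt (fun u => L (Z (r, u)) - fderiv ℝ L (Z (r, u₁)) (Z (r, u)))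
      (D u r) u := by
    intro r u
    have h1 : HasFDerivAt (fun u => Z (r, u))
        ((fderiv ℝ Z (r, u)).comp (ContinuousLinearMap.inr ℝ ℝ (E n))) u :=
      (hZ.differentiable (by norm_num) _).hasFDerivAt.comp u
        (hasFDerivAt_prodMk_right (𝕜 := ℝ) r u)
    exact ((hd _).hasFDerivAt.comp u h1).sub ((fderiv ℝ L (Z (r, u₁))).hasFDerivAt.comp u h1)
  have hev : ∀ᶠ u in 𝓝 u₁, ∀ r ∈ uIcc 0 r₁, ‖D u r‖ < ε := by
    refine isCompact_uIcc.eventually_forall_of_forall_eventually fun r _ => ?_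
    refine hDc.norm.continuousAt.eventually_lt continuousAt_const ?_
    simpa [D] using hε
  obtain ⟨δ, hδ, hball⟩ := Metric.eventually_nhds_iff_ball.mp hev
  filter_upwards [Metric.ball_mem_nhds u₁ hδ] with u hu
  have hrem : ∀ r ∈ uIcc 0 r₁, ‖L (Z (r, u)) - L (Z (r, u₁)) -
      fderiv ℝ L (Z (r, u₁)) (Z (r, u) - Z (r, u₁))‖ ≤ ε * ‖u - u₁‖ := by
    intro r hr
    have h := (convex_ball u₁ δ).norm_image_sub_le_of_norm_hasFDerivWithin_le
      (fun v _ => (hψ r v).hasFDerivWithinAt) (fun v hv => (hball v hv r hr).le)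
      (Metric.mem_ball_self hδ) hu
    convert! h using 2
    rw [map_sub]; ring
  have hcont : ∀ v, Continuous fun r => L (Z (r, v)) := fun v => by
    have := hZ.continuous; have := hL.continuous; fun_prop
  have hcont' : Continuous fun r => fderiv ℝ L (Z (r, u₁)) (Z (r, u) - Z (r, u₁)) := by
    have hZc := hZ.continuous
    fun_prop
  have hFTC : ∫ r in (0 : ℝ)..r₁, fderiv ℝ L (Z (r, u₁)) (Z (r, u) - Z (r, u₁)) =
      flowMom L φ x₀ (r₁, u₁) (flowPos φ x₀ (r₁, u) - flowPos φ x₀ (r₁, u₁)) := by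
    have hder : ∀ r, HasDerivAt
        (fun r => flowMom L φ x₀ (r, u₁) (flowPos φ x₀ (r, u) - flowPos φ x₀ (r, u₁)))
        (fderiv ℝ L (Z (r, u₁)) (Z (r, u) - Z (r, u₁))) r := by
      intro r
      have h := (hφ.hasDerivAt_flowMom x₀ u₁ r).clm_apply
        ((hφ.hasDerivAt_flowPos x₀ u r).sub (hφ.hasDerivAt_flowPos x₀ u₁ r))
      rw [fderiv_apply_eq_partial hd]
      exact h
    rw [intervalIntegral.integral_eq_sub_of_hasDerivAt (fun r _ => hder r)
      (hcont'.intervalIntegrable _ _)]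
    simp [hφ.flowPos_zero]
  have heq : flowAction L φ x₀ (r₁, u) - flowAction L φ x₀ (r₁, u₁) -
      flowMom L φ x₀ (r₁, u₁) (flowPos φ x₀ (r₁, u) - flowPos φ x₀ (r₁, u₁)) =
      ∫ r in (0 : ℝ)..r₁, (L (Z (r, u)) - L (Z (r, u₁)) -
        fderiv ℝ L (Z (r, u₁)) (Z (r, u) - Z (r, u₁))) := by
    have hcs : Continuous fun r => L (Z (r, u)) - L (Z (r, u₁)) := (hcont u).sub (hcont u₁)
    rw [intervalIntegral.integral_sub (hcs.intervalIntegrable _ _)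
      (hcont'.intervalIntegrable _ _), intervalIntegral.integral_sub
      ((hcont u).intervalIntegrable _ _) ((hcont u₁).intervalIntegrable _ _), hFTC]
    rfl
  rw [heq]
  have h := intervalIntegral.norm_integral_le_of_norm_le_const
    (a := 0) (b := r₁) (fun r hr => hrem r (uIoc_subset_uIcc hr))
  simpa using h

/-- First variation of the action with respect to time and initial velocity. -/
lemma flowAction_isLittleO (hφ : IsELFlow n k L φ) (hk : 2 ≤ k) (hL : ContDiff ℝ 2 L)
    (q₁ : ℝ × E n) :
    (fun q => flowAction L φ x₀ q - flowAction L φ x₀ q₁ -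
      flowMom L φ x₀ q₁ (flowPos φ x₀ q - flowPos φ x₀ q₁) -
      (L (φ q₁.1 (x₀, q₁.2)) - flowMom L φ x₀ q₁ (flowVel φ x₀ q₁)) * (q.1 - q₁.1))
      =o[𝓝 q₁] fun q => q - q₁ := by
  obtain ⟨r₁, u₁⟩ := q₁
  set p := flowMom L φ x₀ (r₁, u₁)
  set h₁ := L (φ r₁ (x₀, u₁)) - p (flowVel φ x₀ (r₁, u₁)) with hh₁
  refine isLittleO_iff.mpr fun c hc => ?_
  obtain ⟨ε, hε, hεc⟩ : ∃ ε : ℝ, 0 < ε ∧ ε * (|r₁| + 1) ≤ c :=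
    ⟨c / (|r₁| + 1), by positivity, by field_simp; exact le_rfl⟩
  have hA := hφ.flowAction_fixed_time x₀ hk hL r₁ u₁ hε
  have hκ : ∀ᶠ q : ℝ × E n in 𝓝 (r₁, u₁),
      ‖L (φ q.1 (x₀, q.2)) - p (flowVel φ x₀ q) - h₁‖ < ε := by
    have hcl := hφ.continuous_lagrangian x₀ hk hL
    have hcv := (hφ.contDiff_flowVel x₀ hk).continuous
    have hcc : Continuous fun q : ℝ × E n =>
        ‖L (φ q.1 (x₀, q.2)) - p (flowVel φ x₀ q) - h₁‖ :=
      ((hcl.sub (p.continuous.comp hcv)).sub continuous_const).norm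
    refine hcc.continuousAt.eventually_lt continuousAt_const ?_
    simpa [hh₁] using hε
  obtain ⟨δ, hδ, hball⟩ := Metric.eventually_nhds_iff_ball.mp hκ
  have hA' : ∀ᶠ q : ℝ × E n in 𝓝 (r₁, u₁),
      |flowAction L φ x₀ (r₁, q.2) - flowAction L φ x₀ (r₁, u₁) -
      p (flowPos φ x₀ (r₁, q.2) - flowPos φ x₀ (r₁, u₁))| ≤ ε * ‖q.2 - u₁‖ * |r₁| :=
    (continuous_snd.tendsto ((r₁, u₁) : ℝ × E n)).eventually hA
  filter_upwards [Metric.ball_mem_nhds _ hδ, hA']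
  rintro ⟨r, u⟩ hq hqA
  rw [← ball_prod_same] at hball hq
  have hB := (convex_ball r₁ δ).norm_image_sub_le_of_norm_hasDerivWithin_le
    (f := fun r => flowAction L φ x₀ (r, u) - p (flowPos φ x₀ (r, u)) - h₁ * r)
    (f' := fun r => L (φ r (x₀, u)) - p (flowVel φ x₀ (r, u)) - h₁) (C := ε)
    (fun s _ => by
      have h1 := ((hφ.hasDerivAt_flowAction x₀ hk hL u s).sub
        (p.hasFDerivAt.comp_hasDerivAt s (hφ.hasDerivAt_flowPos x₀ u s))).sub
        ((hasDerivAt_id s).const_mul h₁)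
      simp only [mul_one] at h1
      exact h1.hasDerivWithinAt)
    (fun s hs => (hball (s, u) ⟨hs, hq.2⟩).le) (Metric.mem_ball_self hδ) hq.1
  simp only at hB hqA ⊢
  have n1 : ‖r - r₁‖ ≤ ‖((r, u) : ℝ × E n) - (r₁, u₁)‖ :=
    norm_fst_le (((r, u) : ℝ × E n) - (r₁, u₁))
  have n2 : ‖u - u₁‖ ≤ ‖((r, u) : ℝ × E n) - (r₁, u₁)‖ :=
    norm_snd_le (((r, u) : ℝ × E n) - (r₁, u₁))
  set N := ‖((r, u) : ℝ × E n) - (r₁, u₁)‖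
  calc ‖flowAction L φ x₀ (r, u) - flowAction L φ x₀ (r₁, u₁) -
        p (flowPos φ x₀ (r, u) - flowPos φ x₀ (r₁, u₁)) - h₁ * (r - r₁)‖
      = ‖(flowAction L φ x₀ (r, u) - p (flowPos φ x₀ (r, u)) - h₁ * r -
          (flowAction L φ x₀ (r₁, u) - p (flowPos φ x₀ (r₁, u)) - h₁ * r₁)) +
        (flowAction L φ x₀ (r₁, u) - flowAction L φ x₀ (r₁, u₁) -
          p (flowPos φ x₀ (r₁, u) - flowPos φ x₀ (r₁, u₁)))‖ := by
        congr 1; simp only [map_sub]; ring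
    _ ≤ ε * ‖r - r₁‖ + ε * ‖u - u₁‖ * |r₁| := (norm_add_le _ _).trans (add_le_add hB hqA)
    _ ≤ ε * N + ε * N * |r₁| := by gcongr
    _ = ε * (|r₁| + 1) * N := by ring
    _ ≤ c * N := by gcongr

end IsELFlow

end Flow

section Energy

open Set Filter Topology

variable {n k : ℕ} {L : E n × E n → ℝ}

/-- The energy `∂L/∂v(x,v)·v - L(x,v)`. -/
def energy (L : E n × E n → ℝ) (x v : E n) : ℝ := partialV n L x v v - L (x, v)

lemma IsExtremal.energy_eq (hL : IsTonelliLagrangian n (k : ℕ∞) L) (hk : 2 ≤ k) {γ : ℝ → E n}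
    (hγ : IsExtremal n L γ) (r : ℝ) :
    energy L (γ r) (deriv γ r) = energy L (γ 0) (deriv γ 0) := by
  have hd : Differentiable ℝ L :=
    (hL.contDiff_two (by exact_mod_cast hk)).differentiable (by norm_num)
  have key : ∀ t, HasDerivAt (fun r => energy L (γ r) (deriv γ r)) 0 t := by
    intro t
    have h1 : HasDerivAt (deriv γ) (deriv (deriv γ) t) t :=
      (hγ.contDiff_deriv.differentiable (by norm_num) t).hasDerivAt
    have h2 := (hγ.2 t).clm_apply h1
    have h3 := (hd (γ t, deriv γ t)).hasFDerivAt.comp_hasDerivAt t ((hγ.hasDerivAt t).prodMk h1)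
    have h4 := h2.sub h3
    rw [fderiv_apply_eq_partial hd] at h4
    convert! h4 using 1
    simp
  exact is_const_of_deriv_eq_zero (fun t => (key t).differentiableAt) (fun t => (key t).deriv) r 0

lemma IsTonelliLagrangian.energy_le (hL : IsTonelliLagrangian n (k : ℕ∞) L) (hk : 2 ≤ k)
    (ρ : ℝ) : ∃ M, ∀ x v, ‖v‖ ≤ ρ → energy L x v ≤ M := by
  obtain ⟨B, hB⟩ := hL.exists_abs_le (2 * ρ)
  obtain ⟨B', hB'⟩ := hL.exists_abs_le ρ
  refine ⟨B + 2 * B', fun x v hv => ?_⟩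
  have h := hL.tangent_le (by exact_mod_cast hk) x v ((2 : ℝ) • v)
  rw [two_smul, add_sub_cancel_right, ← two_smul ℝ] at h
  have h1 := abs_le.mp (hB x ((2 : ℝ) • v) (by rw [norm_smul]; simpa using hv))
  have h2 := abs_le.mp (hB' x v hv)
  unfold energy
  linarith

lemma IsTonelliLagrangian.le_energy (hL : IsTonelliLagrangian n (k : ℕ∞) L) (hk : 2 ≤ k)
    (M : ℝ) : ∃ R, ∀ x v, R ≤ ‖v‖ → M ≤ energy L x v := by
  obtain ⟨B, hB⟩ := hL.exists_abs_le 1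
  obtain ⟨R, hR⟩ := hL.superlinear (M + 2 * B)
  refine ⟨max R 1, fun x v hv => ?_⟩
  have hv1 : 1 ≤ ‖v‖ := (le_max_right _ _).trans hv
  have hv0 : 0 < ‖v‖ := by linarith
  have h1 := hR x v ((le_max_left _ _).trans hv)
  have hw : ‖(‖v‖⁻¹ • v)‖ = 1 := by
    rw [norm_smul, norm_inv, norm_norm, inv_mul_cancel₀ hv0.ne']
  have h2 := hL.tangent_le (by exact_mod_cast hk) x v (‖v‖⁻¹ • v)
  have h3 := hL.tangent_le (by exact_mod_cast hk) x v 0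
  rw [map_sub, map_smul, smul_eq_mul] at h2
  rw [map_sub, map_zero] at h3
  have h4 := abs_le.mp (hB x (‖v‖⁻¹ • v) hw.le)
  have h5 := abs_le.mp (hB x 0 (by simp))
  set p := partialV n L x v v with hp
  have h6 : M + B ≤ ‖v‖⁻¹ * p := by
    rw [le_inv_mul_iff₀ hv0]
    have hB0 : 0 ≤ B := by linarith
    nlinarith
  unfold energy
  linarith

/-- Fast extremals remain fast. -/
lemma IsTonelliLagrangian.le_norm_deriv_extremal (hL : IsTonelliLagrangian n (k : ℕ∞) L)
    (hk : 2 ≤ k) (ρ : ℝ) :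
    ∃ R, ∀ γ, IsExtremal n L γ → R < ‖deriv γ 0‖ → ∀ r, ρ ≤ ‖deriv γ r‖ := by
  obtain ⟨M, hM⟩ := hL.energy_le hk ρ
  obtain ⟨R, hR⟩ := hL.le_energy hk (M + 1)
  refine ⟨R, fun γ hγ h0 r => ?_⟩
  by_contra! h
  have h1 := hM (γ r) _ h.le
  have h2 := hR (γ 0) _ h0.le
  rw [hγ.energy_eq hL hk] at h1
  linarith

lemma IsELFlow.flowAction_coercive {φ : ℝ → E n × E n → E n × E n}
    (hL : IsTonelliLagrangian n (k : ℕ∞) L) (hφ : IsELFlow n k L φ) (hk : 2 ≤ k) (x₀ : E n)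
    (M : ℝ) : ∃ R, ∀ r u, 1 ≤ r → flowAction L φ x₀ (r, u) ≤ M → ‖u‖ ≤ R := by
  obtain ⟨ρ, hρ⟩ := hL.superlinear (|M| + 1)
  obtain ⟨R, hR⟩ := hL.le_norm_deriv_extremal hk (max ρ 1)
  refine ⟨R, fun r u hr hM => ?_⟩
  by_contra! h
  have hv := hR _ (hφ.isExtremal x₀ u) (by rwa [hφ.deriv_flowPos, hφ.flowVel_zero])
  simp only [hφ.deriv_flowPos] at hv
  have hLK : ∀ s, |M| + 1 ≤ L (φ s (x₀, u)) := fun s => by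
    have h1 := hρ (flowPos φ x₀ (s, u)) _ ((le_max_left _ _).trans (hv s))
    have h2 := (le_max_right _ _).trans (hv s)
    have h3 : (|M| + 1) * 1 ≤ (|M| + 1) * ‖flowVel φ x₀ (s, u)‖ := by gcongr
    rw [mul_one] at h3
    exact h3.trans h1
  have hc : Continuous fun s => L (φ s (x₀, u)) :=
    (hφ.continuous_lagrangian x₀ hk (hL.contDiff_two (by exact_mod_cast hk))).comp
      (Continuous.prodMk_left u)
  have h4 := intervalIntegral.integral_mono_on (μ := volume) (a := 0) (b := r) (by linarith)
    (continuous_const.intervalIntegrable _ _) (hc.intervalIntegrable _ _) fun s _ => hLK s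
  rw [intervalIntegral.integral_const, smul_eq_mul, sub_zero] at h4
  have h5 : flowAction L φ x₀ (r, u) = ∫ s in (0 : ℝ)..r, L (φ s (x₀, u)) := rfl
  have h6 := le_abs_self M
  have h7 : 1 * (|M| + 1) ≤ r * (|M| + 1) := by gcongr
  linarith

end Energy

section Weierstrass

open Set Filter Topology Asymptotics

variable {n k : ℕ} {L : E n × E n → ℝ} {φ : ℝ → E n × E n → E n × E n}

/-- The tangent inequality at a velocity `v₁`, uniformly in the base point near `x₁`. -/
lemma IsTonelliLagrangian.eventually_tangent_le (hL : IsTonelliLagrangian n (k : ℕ∞) L)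
    (hk : 2 ≤ k) (x₁ v₁ : E n) {ε : ℝ} (hε : 0 < ε) :
    ∀ᶠ x in 𝓝 x₁, ∀ w, L (x₁, v₁) + partialV n L x₁ v₁ (w - v₁) - ε * (1 + ‖w‖) ≤ L (x, w) := by
  have h2 := hL.contDiff_two (by exact_mod_cast hk)
  obtain ⟨η, hη, hηε⟩ : ∃ η : ℝ, 0 < η ∧ η * (1 + ‖v₁‖) = ε :=
    ⟨ε / (1 + ‖v₁‖), by positivity, by field_simp⟩
  have hc1 : Continuous fun x => ‖L (x, v₁) - L (x₁, v₁)‖ := by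
    have := h2.continuous; fun_prop
  have hc2 : Continuous fun x => ‖partialV n L x v₁ - partialV n L x₁ v₁‖ :=
    (((contDiff_partialV h2).continuous.comp (Continuous.prodMk_left v₁)).sub
      continuous_const).norm
  have e1 : ∀ᶠ x in 𝓝 x₁, ‖L (x, v₁) - L (x₁, v₁)‖ < η :=
    hc1.continuousAt.eventually_lt continuousAt_const (by simpa using hη)
  have e2 : ∀ᶠ x in 𝓝 x₁, ‖partialV n L x v₁ - partialV n L x₁ v₁‖ < η :=
    hc2.continuousAt.eventually_lt continuousAt_const (by simpa using hη)
  filter_upwards [e1, e2] with x h1 h3 w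
  have h4 := hL.tangent_le (by exact_mod_cast hk) x v₁ w
  have h5 := (abs_lt.mp h1).1
  have h6 : |(partialV n L x v₁ - partialV n L x₁ v₁) (w - v₁)| ≤ η * (‖w‖ + ‖v₁‖) :=
    ((partialV n L x v₁ - partialV n L x₁ v₁).le_opNorm _).trans
      (mul_le_mul h3.le (norm_sub_le _ _) (norm_nonneg _) hη.le)
  rw [sub_apply] at h6
  have h7 := (abs_le.mp h6).1
  have h8 : η * (1 + ‖w‖ + ‖v₁‖) ≤ ε * (1 + ‖w‖) := by
    rw [← hηε, mul_assoc]
    gcongr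
    nlinarith [norm_nonneg w, norm_nonneg v₁]
  linarith

/-- **Weierstrass inequality**: along a curve lifted to the field of extremals issued from `x₀`,
the action of the field grows at most as fast as the action of the curve. -/
lemma IsELFlow.flowAction_le (hL : IsTonelliLagrangian n (k : ℕ∞) L) (hφ : IsELFlow n k L φ)
    (hk : 2 ≤ k) (hnc : NoConjugatePoints n φ) (x₀ : E n) {a T : ℝ} (ha : 0 < a) (haT : a ≤ T)
    {C g u : ℝ → E n} (hg : IntervalIntegrable g volume a T)
    (hC : ∀ s ∈ Icc a T, ∀ s' ∈ Icc a T, C s' - C s = ∫ r in s..s', g r)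
    (hLg : IntervalIntegrable (fun r => L (C r, g r)) volume a T)
    (hu : ContinuousOn u (Icc a T)) (hCu : ∀ s ∈ Icc a T, flowPos φ x₀ (s, u s) = C s) :
    flowAction L φ x₀ (T, u T) ≤ flowAction L φ x₀ (a, u a) + ∫ r in a..T, L (C r, g r) := by
  have h2 := hL.contDiff_two (by exact_mod_cast hk)
  have hsub : ∀ {s s'}, s ∈ Icc a T → s' ∈ Icc a T → uIcc s s' ⊆ uIcc a T := fun hs hs' => by
    rw [uIcc_of_le haT]; exact uIcc_subset_Icc hs hs'
  have hN : IntervalIntegrable (fun r => 1 + ‖g r‖) volume a T :=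
    (intervalIntegrable_const).add hg.norm
  have hCc : ContinuousOn C (Icc a T) := by
    have := (hφ.contDiff_flowPos x₀ hk).continuous.comp_continuousOn (continuousOn_id.prodMk hu)
    exact this.congr fun s hs => (hCu s hs).symm
  have local_le : ∀ ε > 0, ∀ x ∈ Ico a T, ∀ᶠ s in 𝓝[>] x, s ∈ Icc a T ∧
      flowAction L φ x₀ (s, u s) - flowAction L φ x₀ (x, u x) ≤
        (∫ r in x..s, L (C r, g r)) + 2 * ε * ∫ r in x..s, (1 + ‖g r‖) := by
    intro ε hε x hx
    have hxm : x ∈ Icc a T := Ico_subset_Icc_self hx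
    have hnhds : 𝓝[>] x ≤ 𝓝[Icc a T] x :=
      nhdsWithin_le_of_mem (mem_of_superset (Ioc_mem_nhdsGT hx.2)
        fun s hs => ⟨hx.1.trans hs.1.le, hs.2⟩)
    have hlit := (hφ.flowAction_isLittleO x₀ hk h2 (x, u x)).trans_isBigO
      (isBigO_sub_of_fderiv_injective (hφ.contDiff_flowPos x₀ hk) fun w hw =>
        hφ.fderiv_flowPos_injective x₀ hk hnc (ha.trans_le hx.1).ne' w hw)
    have hq : Tendsto (fun s => (s, u s)) (𝓝[>] x) (𝓝 (x, u x)) :=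
      ((continuousOn_id.prodMk hu) x hxm).mono_left hnhds
    have e1 := hq.eventually (isLittleO_iff.mp hlit hε)
    have e2 := ((hCc x hxm).mono_left hnhds).eventually
      (hL.eventually_tangent_le hk (C x) (flowVel φ x₀ (x, u x)) hε)
    obtain ⟨y, hxy, hy⟩ := mem_nhdsGT_iff_exists_Ioo_subset.mp e2
    filter_upwards [e1, Ioo_mem_nhdsGT hxy, Ioc_mem_nhdsGT hx.2] with s h1 hsy hsT
    have hs : s ∈ Icc a T := ⟨hx.1.trans hsT.1.le, hsT.2⟩
    refine ⟨hs, ?_⟩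
    have hxs : x ≤ s := hsT.1.le
    set v₁ := flowVel φ x₀ (x, u x) with hv₁
    set p := partialV n L (C x) v₁ with hp
    have hmom : flowMom L φ x₀ (x, u x) = p := by rw [hp, ← hCu x hxm]; rfl
    have hL1 : L (φ x (x₀, u x)) = L (C x, v₁) := by rw [← hCu x hxm]; rfl
    have hgi := hg.mono_set (hsub hxm hs)
    have hNi := hN.mono_set (hsub hxm hs)
    have hIi := hLg.mono_set (hsub hxm hs)
    have hpi : IntervalIntegrable (fun r => p (g r)) volume x s :=
      ⟨p.integrable_comp hgi.1, p.integrable_comp hgi.2⟩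
    have hlow : ∫ r in x..s, (L (C x, v₁) - p v₁ + p (g r) - ε * (1 + ‖g r‖)) ≤
        ∫ r in x..s, L (C r, g r) := by
      refine intervalIntegral.integral_mono_on_of_le_Ioo hxs
        ((intervalIntegrable_const.add hpi).sub (hNi.const_mul ε)) hIi fun r hr => ?_
      have h := hy ⟨hr.1, hr.2.trans hsy.2⟩ (g r)
      rw [map_sub] at h
      linarith
    rw [intervalIntegral.integral_sub (intervalIntegrable_const.add hpi) (hNi.const_mul ε),
      intervalIntegral.integral_add intervalIntegrable_const hpi,
      intervalIntegral.integral_const, intervalIntegral.integral_const_mul,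
      p.intervalIntegral_comp_comm hgi, ← hC x hxm s hs, smul_eq_mul] at hlow
    have hdist : ‖((s - x, C s - C x) : ℝ × E n)‖ ≤ ∫ r in x..s, (1 + ‖g r‖) := by
      rw [intervalIntegral.integral_add intervalIntegrable_const hgi.norm,
        intervalIntegral.integral_const, smul_eq_mul, mul_one]
      have h3 : ‖C s - C x‖ ≤ ∫ r in x..s, ‖g r‖ := by
        rw [hC x hxm s hs]; exact intervalIntegral.norm_integral_le_integral_norm hxs
      have h4 : ‖s - x‖ = s - x := by rw [Real.norm_eq_abs, abs_of_nonneg (by linarith)]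
      rw [Prod.norm_def, max_le_iff]
      constructor
      · have := norm_nonneg (C s - C x)
        simp only [h4]; linarith
      · simp only; linarith
    simp only [hmom, hL1, hCu s hs, hCu x hxm] at h1
    have h5 := (le_abs_self _).trans (h1.trans (mul_le_mul_of_nonneg_left hdist hε.le))
    linarith
  have global_le : ∀ ε > 0, flowAction L φ x₀ (T, u T) ≤ flowAction L φ x₀ (a, u a) +
      (∫ r in a..T, L (C r, g r)) + 2 * ε * ∫ r in a..T, (1 + ‖g r‖) := by
    intro ε hε
    have hS : ContinuousOn (fun s => flowAction L φ x₀ (s, u s)) (Icc a T) :=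
      (hφ.continuous_flowAction x₀ hk h2).comp_continuousOn (continuousOn_id.prodMk hu)
    have hI : ContinuousOn (fun s => ∫ r in a..s, L (C r, g r)) (Icc a T) := by
      have := intervalIntegral.continuousOn_primitive_interval' hLg left_mem_uIcc
      rwa [uIcc_of_le haT] at this
    have hG : ContinuousOn (fun s => ∫ r in a..s, (1 + ‖g r‖)) (Icc a T) := by
      have := intervalIntegral.continuousOn_primitive_interval' hN left_mem_uIcc
      rwa [uIcc_of_le haT] at this
    have hsubset := IsClosed.Icc_subset_of_forall_exists_gt (a := a) (b := T)
      (s := {s | s ∈ Icc a T ∧ flowAction L φ x₀ (s, u s) ≤ flowAction L φ x₀ (a, u a) +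
        (∫ r in a..s, L (C r, g r)) + 2 * ε * ∫ r in a..s, (1 + ‖g r‖)})
      ((isClosed_Icc.isClosed_le hS ((continuousOn_const.add hI).add
        (hG.const_smul (2 * ε)))).inter isClosed_Icc) ⟨left_mem_Icc.mpr haT, by simp⟩ ?_
    · exact (hsubset (right_mem_Icc.mpr haT)).2
    · rintro x ⟨⟨hxm, hx⟩, hxI⟩ y hy
      obtain ⟨s, ⟨hs, hle⟩, hxs⟩ := ((local_le ε hε x hxI).and (Ioc_mem_nhdsGT hy)).exists
      refine ⟨s, ⟨hs, ?_⟩, hxs⟩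
      have ham : a ∈ Icc a T := left_mem_Icc.mpr haT
      rw [← intervalIntegral.integral_add_adjacent_intervals (hLg.mono_set (hsub ham hxm))
        (hLg.mono_set (hsub hxm hs)), ← intervalIntegral.integral_add_adjacent_intervals
        (hN.mono_set (hsub ham hxm)) (hN.mono_set (hsub hxm hs))]
      linarith
  set K := ∫ r in a..T, (1 + ‖g r‖)
  refine le_of_forall_pos_le_add fun δ hδ => ?_
  have h := global_le (δ / (2 * (|K| + 1))) (by positivity)
  have h' : 2 * (δ / (2 * (|K| + 1))) * K ≤ δ := by
    have : 2 * (δ / (2 * (|K| + 1))) * K = δ * (K / (|K| + 1)) := by field_simp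
    rw [this]
    have : K / (|K| + 1) ≤ 1 := by
      rw [div_le_one (by positivity)]; linarith [le_abs_self K]
    nlinarith
  linarith

end Weierstrass

section Arc

open Set Filter Topology

variable {n : ℕ} {L : E n × E n → ℝ} {C C' g g' : ℝ → E n} {a b c : ℝ}

/-- `C` is an absolutely continuous curve on `[a, b]` with derivative `g` and integrable
Lagrangian. -/
structure IsArc (L : E n × E n → ℝ) (C g : ℝ → E n) (a b : ℝ) : Prop where
  integrable : IntervalIntegrable g volume a b
  sub_eq : ∀ s ∈ Icc a b, ∀ s' ∈ Icc a b, C s' - C s = ∫ r in s..s', g r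
  integrable_action : IntervalIntegrable (fun r => L (C r, g r)) volume a b

namespace IsArc

lemma of_hasDerivAt (hL : Continuous L) (hC : ∀ r, HasDerivAt C (g r) r) (hg : Continuous g) :
    IsArc L C g a b where
  integrable := hg.intervalIntegrable _ _
  sub_eq s _ s' _ := (intervalIntegral.integral_eq_sub_of_hasDerivAt (fun r _ => hC r)
    (hg.intervalIntegrable _ _)).symm
  integrable_action := by
    have hCc : Continuous C := continuous_iff_continuousAt.mpr fun r => (hC r).continuousAt
    exact (hL.comp (hCc.prodMk hg)).intervalIntegrable _ _

lemma congr (h : IsArc L C g a b) (hC : EqOn C C' (Icc a b)) (hg : EqOn g g' (Ioo a b))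
    (hab : a ≤ b) : IsArc L C' g' a b where
  integrable := h.integrable.congr_uIoo (by rwa [uIoo_of_le hab])
  sub_eq s hs s' hs' := by
    rw [← hC hs, ← hC hs', h.sub_eq s hs s' hs']
    refine intervalIntegral.integral_congr_uIoo fun r hr => hg ?_
    exact ⟨(le_min hs.1 hs'.1).trans_lt hr.1, hr.2.trans_le (max_le hs.2 hs'.2)⟩
  integrable_action := h.integrable_action.congr_uIoo fun r hr => by
    rw [uIoo_of_le hab] at hr
    simp only [hC (Ioo_subset_Icc_self hr), hg hr]

lemma mono {a' b' : ℝ} (h : IsArc L C g a b) (ha : a ≤ a') (hab : a' ≤ b') (hb : b' ≤ b) :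
    IsArc L C g a' b' := by
  have hsub : uIcc a' b' ⊆ uIcc a b := by
    rw [uIcc_of_le hab, uIcc_of_le (ha.trans (hab.trans hb))]
    exact Icc_subset_Icc ha hb
  exact ⟨h.integrable.mono_set hsub, fun s hs s' hs' => h.sub_eq s (Icc_subset_Icc ha hb hs) s'
    (Icc_subset_Icc ha hb hs'), h.integrable_action.mono_set hsub⟩

lemma trans (h : IsArc L C g a b) (h' : IsArc L C g b c) (hab : a ≤ b) (hbc : b ≤ c) :
    IsArc L C g a c where
  integrable := h.integrable.trans h'.integrable
  integrable_action := h.integrable_action.trans h'.integrable_action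
  sub_eq := by
    have hi := h.integrable.trans h'.integrable
    have hsub : ∀ {s s'}, s ∈ Icc a c → s' ∈ Icc a c → IntervalIntegrable g volume s s' :=
      fun hs hs' => hi.mono_set (by
        rw [uIcc_of_le (hab.trans hbc)]; exact uIcc_subset_Icc hs hs')
    have ham : a ∈ Icc a c := left_mem_Icc.mpr (hab.trans hbc)
    have key : ∀ s ∈ Icc a c, C s - C a = ∫ r in a..s, g r := by
      intro s hs
      rcases le_total s b with hsb | hbs
      · exact h.sub_eq a (left_mem_Icc.mpr hab) s ⟨hs.1, hsb⟩
      · rw [← intervalIntegral.integral_add_adjacent_intervals h.integrable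
          (hsub ⟨hab, hbc⟩ hs), ← h.sub_eq a (left_mem_Icc.mpr hab) b (right_mem_Icc.mpr hab),
          ← h'.sub_eq b (left_mem_Icc.mpr hbc) s ⟨hbs, hs.2⟩]
        abel
    intro s hs s' hs'
    rw [← intervalIntegral.integral_interval_sub_left (hsub ham hs') (hsub ham hs),
      ← key s hs, ← key s' hs']
    abel

end IsArc

end Arc

section Minimizing

open Set Filter Topology

variable {n k : ℕ} {L : E n × E n → ℝ} {φ : ℝ → E n × E n → E n × E n}

/-- Curves of finite action lift to the field of extremals issued from `x₀`. -/
lemma IsELFlow.exists_lift (hL : IsTonelliLagrangian n (k : ℕ∞) L) (hφ : IsELFlow n k L φ)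
    (hk : 2 ≤ k) (hnc : NoConjugatePoints n φ) (x₀ : E n) {e : ℝ} (he : 1 ≤ e)
    {C g : ℝ → E n} (hCc : Continuous C) (hC : IsArc L C g 1 e) {v₀ : E n}
    (hv₀ : flowPos φ x₀ (1, v₀) = C 1) :
    ∃ u : ℝ → E n, ContinuousOn u (Icc 1 e) ∧ u 1 = v₀ ∧
      ∀ s ∈ Icc 1 e, flowPos φ x₀ (s, u s) = C s := by
  obtain ⟨B, hB0, hB⟩ := hL.exists_neg_le
  obtain ⟨R, hR⟩ := hφ.flowAction_coercive hL hk x₀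
    (flowAction L φ x₀ (1, v₀) + (∫ r in (1 : ℝ)..e, L (C r, g r)) + B * (e - 1))
  have hpos := hφ.contDiff_flowPos x₀ hk
  obtain ⟨U, hU, hU1, hUl⟩ := exists_path_lift
    (P := fun q : ℝ × E n => (q.1, flowPos φ x₀ q)) (K := Icc 1 e ×ˢ Metric.closedBall 0 R)
    (γ := fun s => (s, C s)) (x₀ := (1, v₀)) (continuous_fst.prodMk hpos.continuous)
    (isCompact_Icc.prod (isCompact_closedBall _ _))
    (fun q hq => exists_openPartialHomeomorph hpos fun w hw =>
      hφ.fderiv_flowPos_injective x₀ hk hnc (by linarith [hq.1.1]) w hw)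
    (continuous_id.prodMk hCc) he (by simp only [hv₀])
    (by
      intro T hT U hU hU1 hUl
      have hfst : ∀ s ∈ Icc 1 T, (U s).1 = s := fun s hs => congrArg Prod.fst (hUl s hs)
      have hsnd : ∀ s ∈ Icc 1 T, flowPos φ x₀ (s, (U s).2) = C s := fun s hs =>
        (congrArg (fun r => flowPos φ x₀ (r, (U s).2)) (hfst s hs).symm).trans
          (congrArg Prod.snd (hUl s hs))
      have hTm : T ∈ Icc 1 T := right_mem_Icc.mpr hT.1
      have hCT := hC.mono le_rfl hT.1 hT.2
      have h := hφ.flowAction_le hL hk hnc x₀ one_pos hT.1 (u := fun s => (U s).2)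
        hCT.integrable hCT.sub_eq hCT.integrable_action (continuous_snd.comp_continuousOn hU) hsnd
      have hC' := hC.mono hT.1 hT.2 le_rfl
      have h1 := intervalIntegral.integral_mono_on (μ := volume) hT.2
        intervalIntegrable_const hC'.integrable_action fun r _ => hB (C r, g r)
      rw [intervalIntegral.integral_const, smul_eq_mul] at h1
      have h2 := intervalIntegral.integral_add_adjacent_intervals hCT.integrable_action
        hC'.integrable_action
      have h3 : B * (e - T) ≤ B * (e - 1) := by gcongr; exact hT.1
      simp only [hU1] at h
      refine ⟨by rw [hfst T hTm]; exact hT, ?_⟩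
      rw [mem_closedBall_zero_iff]
      exact hR T _ hT.1 (by linarith))
  refine ⟨fun s => (U s).2, continuous_snd.comp_continuousOn hU, by simp [hU1], fun s hs => ?_⟩
  have h1 : (U s).1 = s := congrArg Prod.fst (hUl s hs)
  exact (congrArg (fun r => flowPos φ x₀ (r, (U s).2)) h1.symm).trans
    (congrArg Prod.snd (hUl s hs))

/-- Lifts of a fixed-endpoints homotopy of curves all end at the same velocity. -/
lemma IsELFlow.lift_end_eq (hφ : IsELFlow n k L φ) (hk : 2 ≤ k) (hnc : NoConjugatePoints n φ)
    (x₀ : E n) {e : ℝ} (he : 1 ≤ e) {c : ℝ → ℝ → E n} (hc : Continuous fun q : ℝ × ℝ => c q.1 q.2)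
    {u : ℝ → ℝ → E n} (hu : ∀ τ, ContinuousOn (u τ) (Icc 1 e)) {v₀ y : E n}
    (h1 : ∀ τ, u τ 1 = v₀) (hcu : ∀ τ, ∀ s ∈ Icc 1 e, flowPos φ x₀ (s, u τ s) = c τ s)
    (hce : ∀ τ, c τ e = y) (τ τ' : ℝ) : u τ e = u τ' e := by
  have he0 : 0 < e := by linarith
  have hE : ContDiff ℝ 1 fun q : ℝ × E n => flowPos φ x₀ (Real.exp q.1, q.2) :=
    (hφ.contDiff_flowPos x₀ hk).comp (f := fun q : ℝ × E n => (Real.exp q.1, q.2)) (by fun_prop)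
  have hinj : ∀ (q : ℝ × E n) (w : E n),
      fderiv ℝ (fun q : ℝ × E n => flowPos φ x₀ (Real.exp q.1, q.2)) q (0, w) = 0 → w = 0 := by
    intro q w hw
    refine hφ.fderiv_flowPos_injective x₀ hk hnc (q := (Real.exp q.1, q.2))
      (Real.exp_pos _).ne' w ?_
    have hd : HasFDerivAt (fun q : ℝ × E n => (Real.exp q.1, q.2))
        ((Real.exp q.1 • ContinuousLinearMap.fst ℝ ℝ (E n)).prod
          (ContinuousLinearMap.snd ℝ ℝ (E n))) q :=
      (hasFDerivAt_fst.exp).prodMk hasFDerivAt_snd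
    have h := ((hφ.contDiff_flowPos x₀ hk).differentiable (by norm_num)
      (Real.exp q.1, q.2)).hasFDerivAt.comp q hd
    have h2 := h.fderiv
    simp only [Function.comp_def] at h2
    rw [h2] at hw
    simpa using hw
  have hP : IsLocalHomeomorph
      fun q : ℝ × E n => (q.1, flowPos φ x₀ (Real.exp q.1, q.2)) := by
    intro q
    obtain ⟨f, hf, hfe⟩ := exists_openPartialHomeomorph hE (hinj q)
    exact ⟨f, hf, hfe.symm⟩
  have hlog : MapsTo Real.exp (Icc 0 (Real.log e)) (Icc 1 e) := fun σ hσ =>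
    ⟨Real.one_le_exp hσ.1, (Real.le_log_iff_exp_le he0).mp hσ.2⟩
  have h := hP.lift_end_eq (H := fun q : ℝ × ℝ => (q.1, c q.2 (Real.exp q.1)))
    (continuous_fst.prodMk (hc.comp (f := fun q : ℝ × ℝ => (q.2, Real.exp q.1)) (by fun_prop)))
    (a := 0) (b := Real.log e) (Real.log_nonneg he) (u := fun τ σ => (σ, u τ (Real.exp σ)))
    (fun τ => continuousOn_id.prodMk ((hu τ).comp Real.continuous_exp.continuousOn hlog))
    (x₀ := (0, v₀)) (fun τ => by simp [h1]) (fun τ σ hσ => by simp only [hcu τ _ (hlog hσ)])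
    (y := (Real.log e, y)) (fun τ => by simp only [Real.exp_log he0, hce]) τ τ'
  simpa [Real.exp_log he0] using h

end Minimizing

section Main

open Set Filter Topology

variable {n k : ℕ} {L : E n × E n → ℝ} {φ : ℝ → E n × E n → E n × E n}

/-- Among absolutely continuous curves on `[1, T]` with the same endpoints, an extremal issued
from `x₀` at time `0` has the least action. -/
lemma IsELFlow.integral_le_of_arc (hL : IsTonelliLagrangian n (k : ℕ∞) L) (hφ : IsELFlow n k L φ)
    (hk : 2 ≤ k) (hnc : NoConjugatePoints n φ) (x₀ v₀ : E n) {T : ℝ} (hT : 1 ≤ T)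
    {D h : ℝ → E n} (hDc : Continuous D) (hD1 : D 1 = 0) (hDT : D T = 0)
    (hD : IsArc L (fun s => flowPos φ x₀ (s, v₀) + D s) (fun s => flowVel φ x₀ (s, v₀) + h s) 1 T) :
    ∫ s in (1 : ℝ)..T, L (φ s (x₀, v₀)) ≤
      ∫ s in (1 : ℝ)..T, L (flowPos φ x₀ (s, v₀) + D s, flowVel φ x₀ (s, v₀) + h s) := by
  have h2 := hL.contDiff_two (by exact_mod_cast hk)
  set γ : ℝ → E n := fun s => flowPos φ x₀ (s, v₀) with hγ
  set γ' : ℝ → E n := fun s => flowVel φ x₀ (s, v₀) with hγ'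
  have hγc : Continuous γ :=
    (hφ.contDiff_flowPos x₀ hk).continuous.comp (Continuous.prodMk_left v₀)
  have hγc' : Continuous γ' :=
    (hφ.contDiff_flowVel x₀ hk).continuous.comp (Continuous.prodMk_left v₀)
  have hγd : ∀ r, HasDerivAt γ (γ' r) r := hφ.hasDerivAt_flowPos x₀ v₀
  let cl : ℝ → ℝ := fun τ => max 1 (min τ T)
  have hcl1 : ∀ τ, 1 ≤ cl τ := fun τ => le_max_left _ _
  have hclT : ∀ τ, cl τ ≤ T := fun τ => max_le hT (min_le_right _ _)
  have hclc : Continuous cl := by fun_prop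
  let c : ℝ → ℝ → E n := fun τ s =>
    γ s + ((T + 1 - max s (cl τ)) / (T + 1 - cl τ)) • D (min s (cl τ))
  let g : ℝ → ℝ → E n := fun τ s =>
    γ' s + if s < cl τ then h s else -(T + 1 - cl τ)⁻¹ • D (cl τ)
  have hne : ∀ τ, T + 1 - cl τ ≠ 0 := fun τ => by linarith [hclT τ]
  have hcc : Continuous fun q : ℝ × ℝ => c q.1 q.2 := by
    have h1 : Continuous fun q : ℝ × ℝ =>
        (T + 1 - max q.2 (cl q.1)) / (T + 1 - cl q.1) :=
      Continuous.div (by fun_prop) (by fun_prop) fun q => hne q.1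
    have h3 : Continuous fun q : ℝ × ℝ => D (min q.2 (cl q.1)) := by fun_prop
    exact (hγc.comp continuous_snd).add (h1.smul h3)
  have hc_le : ∀ τ s, s ≤ cl τ → c τ s = γ s + D s := fun τ s hs => by
    simp only [c, max_eq_right hs, min_eq_left hs, div_self (hne τ), one_smul]
  have hc_ge : ∀ τ s, cl τ ≤ s →
      c τ s = γ s + ((T + 1 - s) / (T + 1 - cl τ)) • D (cl τ) := fun τ s hs => by
    simp only [c, max_eq_left hs, min_eq_right hs]
  have harc1 : ∀ τ, IsArc L (c τ) (g τ) 1 (cl τ) := fun τ =>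
    (hD.mono le_rfl (hcl1 τ) (hclT τ)).congr (fun s hs => (hc_le τ s hs.2).symm)
      (fun s hs => by simp only [g, if_pos hs.2]; rfl) (hcl1 τ)
  have harc2 : ∀ τ, IsArc L (c τ) (g τ) (cl τ) (T + 1) := fun τ => by
    refine (IsArc.of_hasDerivAt (C := fun s =>
      γ s + ((T + 1 - s) / (T + 1 - cl τ)) • D (cl τ))
      (g := fun s => γ' s + -(T + 1 - cl τ)⁻¹ • D (cl τ)) h2.continuous (fun s => ?_)
      (by fun_prop)).congr (fun s hs => (hc_ge τ s hs.1).symm)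
      (fun s hs => by simp only [g, if_neg (not_lt.mpr hs.1.le)]) (by linarith [hclT τ])
    have h3 := (((hasDerivAt_id s).const_sub (T + 1)).div_const (T + 1 - cl τ)).smul_const
      (D (cl τ))
    have h4 := (hγd s).add h3
    rw [neg_div, one_div] at h4
    exact h4
  have harc : ∀ τ, IsArc L (c τ) (g τ) 1 (T + 1) := fun τ =>
    (harc1 τ).trans (harc2 τ) (hcl1 τ) (by linarith [hclT τ])
  have hc1 : ∀ τ, c τ 1 = γ 1 := fun τ => by rw [hc_le τ 1 (hcl1 τ), hD1, add_zero]
  have hclone : cl 1 = 1 := by simp [cl, hT]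
  have hclTT : cl T = T := by simp [cl, hT]
  have hex : ∀ τ, ∃ u : ℝ → E n, ContinuousOn u (Icc 1 (T + 1)) ∧ u 1 = v₀ ∧
      (∀ s ∈ Icc 1 (T + 1), flowPos φ x₀ (s, u s) = c τ s) ∧ (τ = 1 → u = fun _ => v₀) := by
    intro τ
    by_cases hτ : τ = 1
    · refine ⟨fun _ => v₀, continuousOn_const, rfl, fun s hs => ?_, fun _ => rfl⟩
      rw [hτ, hc_ge 1 s (by rw [hclone]; exact hs.1), hclone, hD1, smul_zero, add_zero]
    · obtain ⟨u, hu, hu1, hul⟩ := hφ.exists_lift hL hk hnc x₀ (by linarith)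
        (hcc.comp (Continuous.prodMk_right τ)) (harc τ) (v₀ := v₀) (hc1 τ).symm
      exact ⟨u, hu, hu1, hul, fun h => absurd h hτ⟩
  choose u hu hu1 hul huone using hex
  have hend : u T (T + 1) = v₀ := by
    rw [hφ.lift_end_eq hk hnc x₀ (by linarith) hcc hu hu1 hul (y := γ (T + 1))
      (fun τ => by rw [hc_ge τ _ (by linarith [hclT τ])]; simp) T 1, huone 1 rfl]
  have hW := hφ.flowAction_le hL hk hnc x₀ one_pos (by linarith) (harc T).integrable
    (harc T).sub_eq (harc T).integrable_action (hu T) (hul T)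
  rw [hend, hu1] at hW
  have hcont : Continuous fun s => L (φ s (x₀, v₀)) :=
    (hφ.continuous_lagrangian x₀ hk h2).comp (Continuous.prodMk_left v₀)
  have hS : flowAction L φ x₀ (T + 1, v₀) - flowAction L φ x₀ (1, v₀) =
      (∫ s in (1 : ℝ)..T, L (φ s (x₀, v₀))) + ∫ s in T..(T + 1), L (φ s (x₀, v₀)) := by
    rw [intervalIntegral.integral_add_adjacent_intervals (hcont.intervalIntegrable _ _)
      (hcont.intervalIntegrable _ _)]
    exact intervalIntegral.integral_interval_sub_left (hcont.intervalIntegrable _ _)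
      (hcont.intervalIntegrable _ _)
  have i1 := (harc1 T).integrable_action
  have i2 := (harc2 T).integrable_action
  rw [hclTT] at i1 i2
  rw [← intervalIntegral.integral_add_adjacent_intervals i1 i2] at hW
  have e1 : ∫ s in (1 : ℝ)..T, L (c T s, g T s) = ∫ s in (1 : ℝ)..T, L (γ s + D s, γ' s + h s) :=
    intervalIntegral.integral_congr_Ioo_of_le hT fun s hs => by
      simp only [hc_le T s (by rw [hclTT]; exact hs.2.le), g, hclTT, if_pos hs.2]
  have e2 : ∫ s in T..(T + 1), L (c T s, g T s) = ∫ s in T..(T + 1), L (φ s (x₀, v₀)) :=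
    intervalIntegral.integral_congr_Ioo_of_le (by linarith) fun s hs => by
      simp only [hc_ge T s (by rw [hclTT]; exact hs.1.le), g, hclTT, if_neg (not_lt.mpr hs.1.le),
        hDT, smul_zero, add_zero]
      rfl
  rw [e1, e2] at hW
  linarith


lemma IsExtremal.comp_add_left {γ : ℝ → E n} (hγ : IsExtremal n L γ) (d : ℝ) :
    IsExtremal n L fun r => γ (d + r) := by
  refine ⟨hγ.1.comp (contDiff_const.add contDiff_id), fun t => ?_⟩
  simp only [deriv_comp_const_add]
  exact HasDerivAt.comp_const_add d t (hγ.2 (d + t))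

lemma IsELFlow.flowPos_eq (hL : IsTonelliLagrangian n (k : ℕ∞) L) (hφ : IsELFlow n k L φ)
    (hk : 2 ≤ k) {γ : ℝ → E n} (hγ : IsExtremal n L γ) {r : ℝ} (hr : 0 ≤ r) :
    flowPos φ (γ 0) (r, deriv γ 0) = γ r :=
  (hφ.isExtremal (γ 0) (deriv γ 0)).eq_of_nonneg hL (by exact_mod_cast hk) hγ
    (hφ.flowPos_zero _ _) (by rw [hφ.deriv_flowPos, hφ.flowVel_zero]) hr

lemma IsELFlow.flowVel_eq (hL : IsTonelliLagrangian n (k : ℕ∞) L) (hφ : IsELFlow n k L φ)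
    (hk : 2 ≤ k) {γ : ℝ → E n} (hγ : IsExtremal n L γ) {r : ℝ} (hr : 0 < r) :
    flowVel φ (γ 0) (r, deriv γ 0) = deriv γ r := by
  rw [← hφ.deriv_flowPos]
  refine EventuallyEq.deriv_eq ?_
  filter_upwards [Ioi_mem_nhds hr] with s hs
  exact hφ.flowPos_eq hL hk hγ (le_of_lt hs)

/-- An extremal has the least action on `[0, t]` among curves with the same endpoints. -/
lemma IsELFlow.integral_le_of_curveOf (hL : IsTonelliLagrangian n (k : ℕ∞) L)
    (hφ : IsELFlow n k L φ) (hk : 2 ≤ k) (hnc : NoConjugatePoints n φ) {γ : ℝ → E n}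
    (hγ : IsExtremal n L γ) {t : ℝ} (ht : 0 ≤ t) {g : ℝ → E n}
    (hg : IntervalIntegrable g volume 0 t) (hgt : curveOf n (γ 0) g t = γ t)
    (hLg : IntervalIntegrable (fun s => L (curveOf n (γ 0) g s, g s)) volume 0 t) :
    ∫ s in (0 : ℝ)..t, L (γ s, deriv γ s) ≤
      ∫ s in (0 : ℝ)..t, L (curveOf n (γ 0) g s, g s) := by
  set Γ : ℝ → E n := fun r => γ (-1 + r) with hΓ
  have hΓe : IsExtremal n L Γ := hγ.comp_add_left (-1)
  have hΓ' : ∀ r, deriv Γ r = deriv γ (r - 1) := fun r => by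
    rw [hΓ, deriv_comp_const_add, neg_add_eq_sub]
  have hpos : ∀ r, 0 ≤ r → flowPos φ (Γ 0) (r, deriv Γ 0) = γ (r - 1) := fun r hr => by
    rw [hφ.flowPos_eq hL hk hΓe hr, ← neg_add_eq_sub]
  have hvel : ∀ r, 0 < r → flowVel φ (Γ 0) (r, deriv Γ 0) = deriv γ (r - 1) := fun r hr => by
    rw [hφ.flowVel_eq hL hk hΓe hr, hΓ']
  have hT : 1 ≤ t + 1 := by linarith
  have hcurve : ContinuousOn (curveOf n (γ 0) g) (Icc 0 t) := by
    have h := intervalIntegral.continuousOn_primitive_interval' hg left_mem_uIcc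
    rw [uIcc_of_le ht] at h
    exact continuousOn_const.add h
  have hγc : Continuous γ := hγ.1.continuous
  let cl : ℝ → ℝ := fun s => max 0 (min (s - 1) t)
  have hcl : ∀ s, cl s ∈ Icc 0 t := fun s => ⟨le_max_left _ _, max_le ht (min_le_right _ _)⟩
  have hcl_eq : ∀ s ∈ Icc 1 (t + 1), cl s = s - 1 := fun s hs => by
    simp only [cl]
    rw [min_eq_left (by linarith [hs.2]), max_eq_right (by linarith [hs.1])]
  let D : ℝ → E n := fun s => curveOf n (γ 0) g (cl s) - γ (cl s)
  have hDc : Continuous D :=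
    (hcurve.comp_continuous (by fun_prop) hcl).sub (hγc.comp (by fun_prop))
  have hD1 : D 1 = 0 := by
    simp only [D, hcl_eq 1 (left_mem_Icc.mpr hT), sub_self, curveOf,
      intervalIntegral.integral_same, add_zero]
  have hDT : D (t + 1) = 0 := by
    simp only [D, hcl_eq _ (right_mem_Icc.mpr hT), add_sub_cancel_right, hgt, sub_self]
  let h : ℝ → E n := fun s => g (s - 1) - flowVel φ (Γ 0) (s, deriv Γ 0)
  have hpt : ∀ s ∈ Icc 1 (t + 1),
      curveOf n (γ 0) g (s - 1) = flowPos φ (Γ 0) (s, deriv Γ 0) + D s := fun s hs => by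
    simp only [D, hcl_eq s hs, hpos s (by linarith [hs.1]), add_sub_cancel]
  have hvt : ∀ s, g (s - 1) = flowVel φ (Γ 0) (s, deriv Γ 0) + h s := fun s => by
    simp only [h, add_sub_cancel]
  have harc : IsArc L (fun s => curveOf n (γ 0) g (s - 1)) (fun s => g (s - 1)) 1 (t + 1) := by
    refine ⟨by simpa using hg.comp_sub_right 1, fun s hs s' hs' => ?_,
      by simpa using hLg.comp_sub_right 1⟩
    have hi : ∀ r ∈ Icc 1 (t + 1), IntervalIntegrable g volume 0 (r - 1) := fun r hr =>
      hg.mono_set (by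
        rw [uIcc_of_le ht]
        exact uIcc_subset_Icc (left_mem_Icc.mpr ht) ⟨by linarith [hr.1], by linarith [hr.2]⟩)
    rw [intervalIntegral.integral_comp_sub_right g 1,
      ← intervalIntegral.integral_interval_sub_left (hi s' hs') (hi s hs)]
    simp only [curveOf]
    abel
  have hmain := hφ.integral_le_of_arc hL hk hnc (Γ 0) (deriv Γ 0) hT hDc hD1 hDT
    (harc.congr hpt (fun s _ => hvt s) hT)
  have e1 : ∫ s in (1 : ℝ)..(t + 1), L (φ s (Γ 0, deriv Γ 0)) =
      ∫ s in (0 : ℝ)..t, L (γ s, deriv γ s) := by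
    have := intervalIntegral.integral_comp_sub_right (a := 1) (b := t + 1)
      (fun s => L (γ s, deriv γ s)) 1
    rw [sub_self, add_sub_cancel_right] at this
    rw [← this]
    refine intervalIntegral.integral_congr_Ioo_of_le hT fun s hs => ?_
    have hs0 : 0 < s := one_pos.trans hs.1
    rw [← hpos s hs0.le, ← hvel s hs0]
    rfl
  have e2 : ∫ s in (1 : ℝ)..(t + 1), L (flowPos φ (Γ 0) (s, deriv Γ 0) + D s,
      flowVel φ (Γ 0) (s, deriv Γ 0) + h s) =
      ∫ s in (0 : ℝ)..t, L (curveOf n (γ 0) g s, g s) := by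
    have := intervalIntegral.integral_comp_sub_right (a := 1) (b := t + 1)
      (fun s => L (curveOf n (γ 0) g s, g s)) 1
    rw [sub_self, add_sub_cancel_right] at this
    rw [← this]
    refine intervalIntegral.integral_congr_Ioo_of_le hT fun s hs => ?_
    simp only [← hpt s (Ioo_subset_Icc_self hs), ← hvt s]
  rwa [e1, e2] at hmain

lemma IsExtremal.curveOf_deriv {γ : ℝ → E n} (hγ : IsExtremal n L γ) (t : ℝ) :
    curveOf n (γ 0) (deriv γ) t = γ t := by
  rw [curveOf, intervalIntegral.integral_eq_sub_of_hasDerivAt (fun r _ => hγ.hasDerivAt r)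
    (hγ.contDiff_deriv.continuous.intervalIntegrable _ _), add_sub_cancel]

lemma IsELFlow.isLeast_action (hL : IsTonelliLagrangian n (k : ℕ∞) L)
    (hφ : IsELFlow n k L φ) (hk : 2 ≤ k) (hnc : NoConjugatePoints n φ) {γ : ℝ → E n}
    (hγ : IsExtremal n L γ) {t : ℝ} (ht : 0 ≤ t) :
    IsLeast { A : ℝ | ∃ g : ℝ → E n,
      IntervalIntegrable g volume 0 t ∧
      curveOf n (γ 0) g t = γ t ∧
      IntervalIntegrable (fun s => L (curveOf n (γ 0) g s, g s)) volume 0 t ∧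
      A = ∫ s in (0:ℝ)..t, L (curveOf n (γ 0) g s, g s) }
      (∫ s in (0 : ℝ)..t, L (γ s, deriv γ s)) := by
  have hγc' := hγ.contDiff_deriv.continuous
  constructor
  · refine ⟨deriv γ, hγc'.intervalIntegrable _ _, hγ.curveOf_deriv t, ?_, ?_⟩
    · simp only [hγ.curveOf_deriv]
      exact (hL.smooth.continuous.comp (hγ.1.continuous.prodMk hγc')).intervalIntegrable _ _
    · simp only [hγ.curveOf_deriv]
  · rintro A ⟨g, hg, hgt, hLg, rfl⟩
    exact hφ.integral_le_of_curveOf hL hk hnc hγ ht hg hgt hLg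

end Main

/-- For a Tonelli Lagrangian without conjugate points, every extremal
curve `c : ℝ → ℝⁿ` minimizes the action between any two of its points: for `a < b`,
the action of `c` on `[a, b]` equals `𝒜_{b-a}(c a, c b)`. -/
theorem extremal_minimizes (n k : ℕ) (hn : 1 ≤ n) (hk : 2 ≤ k)
    (L : E n × E n → ℝ) (hL : IsTonelliLagrangian n (k : ℕ∞) L)
    (φ : ℝ → E n × E n → E n × E n) (hφ : IsELFlow n k L φ)
    (hnc : NoConjugatePoints n φ)
    (c : ℝ → E n) (hc : IsExtremal n L c) :
    ∀ a b : ℝ, a < b →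
      (∫ s in a..b, L (c s, deriv c s)) = Acost n L (b - a) (c a) (c b) := by
  intro a b hab
  have h := (hφ.isLeast_action hL hk hnc (hc.comp_add_left a) (sub_nonneg.mpr hab.le)).csInf_eq
  simp only [add_zero, add_sub_cancel, deriv_comp_const_add] at h
  rw [Acost, h, intervalIntegral.integral_comp_add_left (fun s => L (c s, deriv c s)) a, add_zero,
    add_sub_cancel]

end
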